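/- arXiv:1412.1143 — 2 statements merged into one kernel-verified Lean document; each statement's English description precedes it below -/
import Mathlib

section
/- There is a universal constant C > 0 with the following property. Let v_1,...,v_m ∈ ℝ^d be vectors in sub-isotropic position, Σ_{i=1}^m v_i v_iᵀ ⪯ I, such that ‖v_i‖² ≤ ε for all i, and suppose the set {v_1,...,v_m} contains k pairwise disjoint bases (k ≥ 1). Then there exists a basis T ⊆ [m] such that ‖Σ_{i∈T} v_i v_iᵀ‖ ≤ C·(ε + 1/k). -/
noncomputable section

/-- `T ⊆ [m]` is a basis for the vectors `v_1,...,v_m ∈ ℝ^d` if `|T| = d` and the vectors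
`{v_i : i ∈ T}` are linearly independent. -/
def IsBasisSet {m d : ℕ} (v : Fin m → Fin d → ℝ) (T : Finset (Fin m)) : Prop :=
  T.card = d ∧ LinearIndependent ℝ (fun i : T => v i)

namespace ThinBasis

/-- finite-difference derivative -/
def pd {σ R : Type*} [DecidableEq σ] [CommRing R] (f : (σ → R) → R) (i : σ) (x : σ → R) : R :=
  f (x + Pi.single i 1) - f x

/-- affine in every coordinate -/
def Aff {σ R : Type*} [DecidableEq σ] [CommRing R] (f : (σ → R) → R) : Prop :=
  ∀ x i t, f (x + Pi.single i t) = f x + t * pd f i x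

lemma Aff.pd_self {σ R : Type*} [DecidableEq σ] [CommRing R] {f : (σ → R) → R} (hf : Aff f)
    (x : σ → R) (i : σ) (t : R) : pd f i (x + Pi.single i t) = pd f i x := by
  have h : x + Pi.single i t + Pi.single i (1 : R) = x + Pi.single i (t + 1) := by
    rw [add_assoc, ← Pi.single_add]
  unfold pd
  rw [h, hf, hf x i t]
  unfold pd
  ring

lemma Aff.pd_aff {σ R : Type*} [DecidableEq σ] [CommRing R] {f : (σ → R) → R} (hf : Aff f)
    (i : σ) : Aff (pd f i) := by
  intro x j t
  have h : ∀ s : R, x + Pi.single j s + Pi.single i (1 : R) = (x + Pi.single i 1) + Pi.single j s := by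
    intro s; abel
  have e1 := hf (x + Pi.single i 1) j t
  have e2 := hf x j t
  simp only [pd] at e1 e2 ⊢
  rw [h, h, e1, e2]
  ring

lemma pd_comm {σ R : Type*} [DecidableEq σ] [CommRing R] (f : (σ → R) → R)
    (i j : σ) (x : σ → R) : pd (pd f i) j x = pd (pd f j) i x := by
  have h : x + Pi.single j 1 + Pi.single i (1 : R) = (x + Pi.single i 1) + Pi.single j 1 := by
    abel
  simp only [pd, h]
  ring

/-- stable complex function -/
def Stab {σ : Type*} (F : (σ → ℂ) → ℂ) : Prop := ∀ z, (∀ i, 0 < (z i).im) → F z ≠ 0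

lemma stab_im {σ : Type*} [DecidableEq σ] {F : (σ → ℂ) → ℂ} (hA : Aff F) (hS : Stab F)
    (z : σ → ℂ) (hz : ∀ i, 0 < (z i).im) (i : σ) (h0 : pd F i z ≠ 0) :
    (pd F i z * (starRingEnd ℂ) (F z)).im < 0 := by
  set β := pd F i z with hβ
  set α := F z with hα
  have h1 : F (z + Pi.single i (-α / β)) = 0 := by
    rw [hA, ← hβ, ← hα]; field_simp; ring
  have h2 : (z i - α / β).im ≤ 0 := by
    by_contra hcon
    push Not at hcon
    refine hS (z + Pi.single i (-α / β)) ?_ h1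
    intro j
    by_cases hj : j = i
    · subst hj
      have : (z + (Pi.single j (-α / β) : σ → ℂ)) j = z j - α / β := by
        simp; ring
      rw [this]; exact hcon
    · simp [Pi.single_eq_of_ne hj, hz j]
  have h3 : 0 < (α / β).im := by
    have := hz i
    simp only [Complex.sub_im] at h2
    linarith
  have hn : 0 < Complex.normSq β := Complex.normSq_pos.mpr h0
  have h4 : (β * (starRingEnd ℂ) α).im = - ((α / β).im * Complex.normSq β) := by
    rw [Complex.div_im]
    field_simp
    simp [Complex.mul_im]
    ring
  rw [h4]
  nlinarith [mul_pos h3 hn]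

lemma stab_im_le {σ : Type*} [DecidableEq σ] {F : (σ → ℂ) → ℂ} (hA : Aff F) (hS : Stab F)
    (z : σ → ℂ) (hz : ∀ i, 0 < (z i).im) (i : σ) :
    (pd F i z * (starRingEnd ℂ) (F z)).im ≤ 0 := by
  by_cases h0 : pd F i z = 0
  · simp [h0]
  · exact (stab_im hA hS z hz i h0).le

lemma pd_cont {σ : Type*} [DecidableEq σ] {F : (σ → ℂ) → ℂ} (hC : Continuous F) (i : σ) :
    Continuous (pd F i) := by
  unfold pd
  exact (hC.comp (continuous_id.add continuous_const)).sub hC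

lemma stab_im_closed {σ : Type*} [DecidableEq σ] {F : (σ → ℂ) → ℂ} (hA : Aff F) (hS : Stab F)
    (hC : Continuous F) (z : σ → ℂ) (hz : ∀ i, 0 ≤ (z i).im) (i : σ) :
    (pd F i z * (starRingEnd ℂ) (F z)).im ≤ 0 := by
  let G : ℝ → ℝ := fun η =>
    (pd F i (z + fun _ => (η : ℂ) * Complex.I) *
      (starRingEnd ℂ) (F (z + fun _ => (η : ℂ) * Complex.I))).im
  have hp : Continuous (fun η : ℝ => (z + fun _ => (η : ℂ) * Complex.I)) := by fun_prop
  have hG : Continuous G :=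
    Complex.continuous_im.comp (((pd_cont hC i).comp hp).mul
      (Complex.continuous_conj.comp (hC.comp hp)))
  have h0 : G 0 = (pd F i z * (starRingEnd ℂ) (F z)).im := by
    have : (z + fun _ => ((0 : ℝ) : ℂ) * Complex.I) = z := by ext; simp
    simp only [G, this]
  rw [← h0]
  have ht : Filter.Tendsto G (nhdsWithin 0 (Set.Ioi 0)) (nhds (G 0)) :=
    (hG.tendsto 0).mono_left nhdsWithin_le_nhds
  refine le_of_tendsto ht ?_
  filter_upwards [self_mem_nhdsWithin] with η hη
  apply stab_im_le hA hS
  intro j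
  have : (0 : ℝ) < η := hη
  simp
  linarith [hz j]

/-- real stable multiaffine -/
def RS {σ : Type*} [DecidableEq σ] (f : (σ → ℝ) → ℝ) : Prop :=
  Aff f ∧ ∃ F : (σ → ℂ) → ℂ, Aff F ∧ Stab F ∧ Continuous F ∧
    ∀ x : σ → ℝ, F (fun k => (x k : ℂ)) = f x

lemma ofReal_single {σ : Type*} [DecidableEq σ] (x : σ → ℝ) (i : σ) (t : ℝ) :
    (fun k => ((x + (Pi.single i t : σ → ℝ)) k : ℂ)) = (fun k => (x k : ℂ)) + Pi.single i (t : ℂ) := by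
  ext k
  by_cases h : k = i
  · subst h; simp
  · simp [Pi.single_eq_of_ne h]

lemma RS.ray {σ : Type*} [DecidableEq σ] {f : (σ → ℝ) → ℝ} (hf : RS f) {i j : σ} (hij : i ≠ j)
    (x : σ → ℝ) : f x * pd (pd f i) j x ≤ pd f i x * pd f j x := by
  obtain ⟨-, F, hA, hS, hC, hF⟩ := hf
  have hpd : ∀ k y, pd F k (fun l => (y l : ℂ)) = (pd f k y : ℝ) := by
    intro k y
    have := ofReal_single y k 1
    simp only [Complex.ofReal_one] at this
    simp only [pd]
    rw [← this, hF, hF]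
    push_cast; rfl
  have hpd2 : pd (pd F j) i (fun l => (x l : ℂ)) = (pd (pd f j) i x : ℝ) := by
    have := ofReal_single x i 1
    simp only [Complex.ofReal_one] at this
    rw [pd, ← this, hpd, hpd]
    simp only [pd]
    push_cast; rfl
  have h := stab_im_closed hA hS hC ((fun k => (x k : ℂ)) + Pi.single i Complex.I) (by
    intro k
    by_cases hk : k = i
    · subst hk; simp
    · simp [Pi.single_eq_of_ne hk]) j
  rw [hA.pd_aff j, hA, hF, hpd, hpd, hpd2] at h
  rw [pd_comm]
  simp at h
  linarith

/-- above the roots -/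
def Ab {σ : Type*} (f : (σ → ℝ) → ℝ) (x : σ → ℝ) : Prop := ∀ y, x ≤ y → 0 < f y

lemma Ab.mono {σ : Type*} {f : (σ → ℝ) → ℝ} {x y : σ → ℝ} (h : Ab f x) (hxy : x ≤ y) : Ab f y :=
  fun z hz => h z (hxy.trans hz)

lemma le_add_single {σ : Type*} [DecidableEq σ] (x : σ → ℝ) (i : σ) {t : ℝ} (ht : 0 ≤ t) :
    x ≤ x + Pi.single i t := by
  have : (0 : σ → ℝ) ≤ Pi.single i t := by
    intro k
    by_cases h : k = i
    · subst h; simpa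
    · simp [Pi.single_eq_of_ne h]
  exact le_add_of_nonneg_right this

lemma lin_nonneg {a b : ℝ} (h : ∀ t, 0 ≤ t → 0 < a + t * b) : 0 ≤ b := by
  by_contra hb
  push Not at hb
  have ha := h 0 le_rfl
  have := h (a / (-b)) (div_nonneg (by linarith) (by linarith))
  have hb' : b ≠ 0 := hb.ne
  have e : a / (-b) * b = -a := by field_simp
  rw [e] at this
  linarith

lemma Ab.pd_nonneg {σ : Type*} [DecidableEq σ] {f : (σ → ℝ) → ℝ} (hA : Aff f) {x : σ → ℝ}
    (h : Ab f x) (i : σ) : 0 ≤ pd f i x := by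
  refine lin_nonneg (a := f x) (fun t ht => ?_)
  rw [← hA]
  exact h _ (le_add_single x i ht)

lemma orthant_ind {σ : Type*} [Fintype σ] [DecidableEq σ] (P : (σ → ℝ) → Prop) (x : σ → ℝ)
    (h0 : P x) (hs : ∀ z, x ≤ z → ∀ j t, 0 ≤ t → P z → P (z + Pi.single j t))
    (y : σ → ℝ) (hy : x ≤ y) : P y := by
  have key : ∀ s : Finset σ, P (x + ∑ j ∈ s, Pi.single j (y j - x j)) ∧
      x ≤ x + ∑ j ∈ s, Pi.single j (y j - x j) := by
    intro s
    induction s using Finset.induction_on with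
    | empty => simpa using h0
    | insert j s hj ih =>
      rw [Finset.sum_insert hj, add_comm (Pi.single j _), ← add_assoc]
      have := sub_nonneg.mpr (hy j)
      exact ⟨hs _ ih.2 _ _ this ih.1, ih.2.trans (le_add_single _ _ this)⟩
  have := (key Finset.univ).1
  have e : x + ∑ j, Pi.single j (y j - x j) = y := by
    rw [Finset.univ_sum_single (fun j => y j - x j)]
    ext; simp
  rwa [e] at this

lemma RS.pd_le {σ : Type*} [Fintype σ] [DecidableEq σ] {f : (σ → ℝ) → ℝ} (hf : RS f)
    {x : σ → ℝ} (hx : Ab f x) {i : σ} {c : ℝ} (hc : pd f i x ≤ c * f x)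
    (y : σ → ℝ) (hy : x ≤ y) : pd f i y ≤ c * f y := by
  refine orthant_ind (fun y => pd f i y ≤ c * f y) x hc ?_ y hy
  intro z hz j t ht h
  have hz' := hx.mono hz
  have hB := hz'.pd_nonneg hf.1 j
  have hC := hz'.pd_nonneg hf.1 i
  have hA := hz' z le_rfl
  have hc0 : 0 ≤ c := by
    by_contra hcon
    push Not at hcon
    nlinarith
  by_cases hij : i = j
  · subst hij
    rw [hf.1.pd_self, hf.1]
    nlinarith [mul_nonneg hc0 (mul_nonneg ht hB)]
  · rw [hf.1.pd_aff i, hf.1]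
    have hr := hf.ray hij z
    have : pd (pd f i) j z ≤ c * pd f j z := by
      have : f z * pd (pd f i) j z ≤ f z * (c * pd f j z) := by nlinarith
      exact le_of_mul_le_mul_left this hA
    nlinarith

/-- averaging operator -/
def Ex {σ R : Type*} [DecidableEq σ] [Field R] (i j : σ) (f : (σ → R) → R) (x : σ → R) : R :=
  (f (x - Pi.single i 1) + f (x - Pi.single j 1)) / 2

lemma Aff.sub_one {σ R : Type*} [DecidableEq σ] [CommRing R] {f : (σ → R) → R} (hf : Aff f)
    (x : σ → R) (i : σ) : f (x - Pi.single i 1) = f x - pd f i x := by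
  have : x - Pi.single i (1 : R) = x + Pi.single i (-1) := by
    rw [Pi.single_neg]; abel
  rw [this, hf]; ring

lemma Aff.ex_eq {σ R : Type*} [DecidableEq σ] [Field R] [CharZero R] {f : (σ → R) → R} (hf : Aff f)
    (x : σ → R) (i j : σ) : Ex i j f x = f x - (pd f i x + pd f j x) / 2 := by
  rw [Ex, hf.sub_one, hf.sub_one]; field_simp; ring

lemma pd_ex {σ R : Type*} [DecidableEq σ] [Field R] (f : (σ → R) → R) (i j k : σ) (x : σ → R) :
    pd (Ex i j f) k x = Ex i j (pd f k) x := by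
  simp only [pd, Ex]
  have h : ∀ l, x + Pi.single k 1 - Pi.single l (1 : R) = x - Pi.single l 1 + Pi.single k 1 := by
    intro l; abel
  rw [h, h]; ring

lemma Aff.ex {σ R : Type*} [DecidableEq σ] [Field R] {f : (σ → R) → R} (hf : Aff f)
    (i j : σ) : Aff (Ex i j f) := by
  intro x k t
  rw [pd_ex]
  have h : ∀ l, x + Pi.single k t - Pi.single l (1 : R) = x - Pi.single l 1 + Pi.single k t := by
    intro l; abel
  simp only [Ex, h]
  rw [hf, hf]; ring

lemma RS.ex {σ : Type*} [DecidableEq σ] {f : (σ → ℝ) → ℝ} (hf : RS f) (i j : σ) :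
    RS (Ex i j f) := by
  obtain ⟨hAf, F, hA, hS, hC, hF⟩ := hf
  refine ⟨hAf.ex i j, Ex i j F, hA.ex i j, ?_, ?_, ?_⟩
  · intro z hz h
    rw [hA.ex_eq] at h
    have h0 := hS z hz
    have e : F z = (pd F i z + pd F j z) / 2 := by linear_combination h
    have e2 : (F z * (starRingEnd ℂ) (F z)).im = 0 := by
      rw [Complex.mul_conj]; simp
    have e3 : (F z * (starRingEnd ℂ) (F z)).im =
        ((pd F i z * (starRingEnd ℂ) (F z)).im + (pd F j z * (starRingEnd ℂ) (F z)).im) / 2 := by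
      conv_lhs => rw [show F z * (starRingEnd ℂ) (F z) = ((pd F i z * (starRingEnd ℂ) (F z)) + (pd F j z * (starRingEnd ℂ) (F z))) / 2 by
        linear_combination e * (starRingEnd ℂ) (F z)]
      rw [Complex.div_ofNat_im, Complex.add_im]
    have hi := stab_im_le hA hS z hz i
    have hj := stab_im_le hA hS z hz j
    have i0 : pd F i z = 0 := by
      by_contra hcon
      have := stab_im hA hS z hz i hcon
      linarith
    have j0 : pd F j z = 0 := by
      by_contra hcon
      have := stab_im hA hS z hz j hcon
      linarith
    rw [i0, j0] at e
    simp at e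
    exact h0 e
  · unfold Ex
    exact ((hC.comp (continuous_id.sub continuous_const)).add
      (hC.comp (continuous_id.sub continuous_const))).div_const _
  · intro x
    have h : ∀ l : σ, (fun k => (x k : ℂ)) - Pi.single l 1 =
        fun k => ((x - (Pi.single l (1 : ℝ) : σ → ℝ)) k : ℂ) := by
      intro l
      have := ofReal_single x l (-1)
      rw [sub_eq_add_neg, sub_eq_add_neg, ← Pi.single_neg, ← Pi.single_neg, this]
      simp
    simp only [Ex, h, hF]
    push_cast; rfl

lemma quad_pos {a0 a1 a2 : ℝ}
    (h : ∀ t, 0 ≤ t → 0 < a0 + a1 * t + a2 * t ^ 2 - (a1 + 2 * a2 * t) / 2) : 0 < a0 := by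
  by_contra hcon
  push Not at hcon
  have h0 := h 0 le_rfl
  simp at h0
  have h1 : a1 < 0 := by linarith
  by_cases h2 : 0 < a2
  · have := h (-a1 / (2 * a2)) (div_nonneg (by linarith) (by linarith))
    have e : a0 + a1 * (-a1 / (2 * a2)) + a2 * (-a1 / (2 * a2)) ^ 2 -
        (a1 + 2 * a2 * (-a1 / (2 * a2))) / 2 = a0 - a1 ^ 2 / (4 * a2) := by
      field_simp; ring
    rw [e] at this
    have : 0 ≤ a1 ^ 2 / (4 * a2) := by positivity
    linarith
  · push Not at h2
    have := h 1 (by norm_num)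
    linarith

lemma Aff.two {σ : Type*} [DecidableEq σ] {f : (σ → ℝ) → ℝ} (hf : Aff f) (x : σ → ℝ) (i j : σ)
    (s t : ℝ) : f (x + Pi.single i s + Pi.single j t) =
      f x + s * pd f i x + t * (pd f j x + s * pd (pd f j) i x) := by
  rw [hf, hf, hf.pd_aff j]

lemma choice {σ : Type*} [Fintype σ] [DecidableEq σ] {f : (σ → ℝ) → ℝ} (hf : RS f) {i j : σ}
    {x : σ → ℝ} (hx : Ab (Ex i j f) x) :
    Ab f (x - Pi.single i 1) ∨ Ab f (x - Pi.single j 1) := by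
  have h1 : Ab f x := by
    intro y hy
    refine quad_pos (a0 := f y) (a1 := pd f i y + pd f j y) (a2 := pd (pd f j) i y) ?_
    intro t ht
    have := hx (y + Pi.single i t + Pi.single j t)
      (hy.trans ((le_add_single _ _ ht).trans (le_add_single _ _ ht)))
    rw [hf.1.ex_eq, hf.1.two, (hf.1.pd_aff i), hf.1.pd_self, hf.1.pd_self, hf.1.pd_aff j,
      pd_comm f i j] at this
    have hc : pd (pd f j) i (y + Pi.single i t) = pd (pd f j) i y := (hf.1.pd_aff j).pd_self _ _ _
    rw [hc] at this
    linarith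
  have gen : ∀ l, 0 < f (x - Pi.single l 1) → Ab f (x - Pi.single l 1) := by
    intro l hl y hy
    rw [hf.1.sub_one] at hl
    have hx0 := h1 x le_rfl
    have h2 := hf.pd_le h1 (i := l) (c := pd f l x / f x) (by field_simp; rfl)
      (y + Pi.single l 1) (by
        have := add_le_add_left hy (Pi.single l (1:ℝ))
        simpa using this)
    have hy0 := h1 (y + Pi.single l 1) (by
        have := add_le_add_left hy (Pi.single l (1:ℝ))
        simpa using this)
    have e := hf.1.sub_one (y + Pi.single l 1) l
    rw [add_sub_cancel_right] at e
    rw [e]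
    have : pd f l x / f x < 1 := by rw [div_lt_one hx0]; linarith
    nlinarith
  have h0 := hx x le_rfl
  unfold Ex at h0
  by_cases hi : 0 < f (x - Pi.single i 1)
  · exact Or.inl (gen i hi)
  · exact Or.inr (gen j (by push Not at hi; linarith))

lemma barrier_alg {a0 a1 a2 b0 b1 b2 φ δ : ℝ} (ha0 : 0 < a0) (ha1 : 0 ≤ a1) (ha2 : 0 ≤ a2)
    (hW : ∀ t, (a0 + a1 * t + a2 * t ^ 2) * (b1 + 2 * b2 * t) ≤
      (a1 + 2 * a2 * t) * (b0 + b1 * t + b2 * t ^ 2))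
    (hφ : φ < 1) (hδ : 0 < δ) (hd : 1 ≤ 2 * (1 - φ) * δ) (hb : b0 ≤ φ * a0)
    (hf : a1 + 2 * a2 * δ ≤ 2 * φ * (a0 + a1 * δ + a2 * δ ^ 2)) :
    b0 + b1 * δ + b2 * δ ^ 2 - (b1 + 2 * b2 * δ) / 2 ≤
      φ * (a0 + a1 * δ + a2 * δ ^ 2 - (a1 + 2 * a2 * δ) / 2) := by
  obtain ⟨P, hP⟩ : ∃ P, P = a1 * b0 - a0 * b1 := ⟨_, rfl⟩
  obtain ⟨Q, hQ⟩ : ∃ Q, Q = a2 * b0 - a0 * b2 := ⟨_, rfl⟩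
  obtain ⟨S, hS⟩ : ∃ S, S = a2 * b1 - a1 * b2 := ⟨_, rfl⟩
  have hq : ∀ t, 0 ≤ P + 2 * Q * t + S * t ^ 2 := by
    intro t
    have := hW t
    rw [hP, hQ, hS]
    linarith
  have hrel : a1 * Q = a0 * S + a2 * P := by rw [hP, hQ, hS]; ring
  have hP0 : 0 ≤ P := by simpa using hq 0
  have hdisc : Q ^ 2 ≤ P * S := by
    have := discrim_le_zero (a := S) (b := 2 * Q) (c := P) (fun t => by have := hq t; linarith)
    unfold discrim at this
    linarith
  have hS0 : 0 ≤ S := by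
    by_contra hcon
    push Not at hcon
    have hPS : P * S ≤ 0 := mul_nonpos_of_nonneg_of_nonpos hP0 hcon.le
    have hQ0 : Q = 0 := by
      have : Q ^ 2 ≤ 0 := by linarith
      exact pow_eq_zero_iff (two_ne_zero) |>.mp (le_antisymm this (sq_nonneg _))
    have := hq (P / (-S) + 1)
    rw [hQ0] at this
    have hk : 0 ≤ P / (-S) := div_nonneg hP0 (by linarith)
    have hS' : S ≠ 0 := hcon.ne
    have hk2 : P / (-S) * S = -P := by field_simp
    nlinarith
  have hQ0 : 0 ≤ Q := by
    rcases ha1.eq_or_lt with h | h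
    · rw [← h] at hrel
      have : a0 * S = 0 := by nlinarith [mul_nonneg ha0.le hS0, mul_nonneg ha2 hP0]
      have hS' : S = 0 := by
        rcases mul_eq_zero.mp this with h | h
        · linarith
        · exact h
      rw [hS', mul_zero] at hdisc
      have : Q = 0 := pow_eq_zero_iff (two_ne_zero) |>.mp (le_antisymm hdisc (sq_nonneg _))
      linarith
    · by_contra hcon
      push Not at hcon
      nlinarith [mul_nonneg ha0.le hS0, mul_nonneg ha2 hP0, mul_neg_of_pos_of_neg h hcon]
  have hkey : a0 * Q ≤ a1 * P := by
    rcases hQ0.eq_or_lt with h | h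
    · rw [← h]; simp; positivity
    · have hPp : 0 < P := by
        rcases hP0.eq_or_lt with h' | h'
        · rw [← h'] at hdisc; nlinarith
        · exact h'
      have ha1p : 0 < a1 := by
        rcases ha1.eq_or_lt with h' | h'
        · exfalso
          rw [← h'] at hrel
          have : a0 * S = 0 := by nlinarith [mul_nonneg ha0.le hS0, mul_nonneg ha2 hP0]
          rcases mul_eq_zero.mp this with h2 | h2
          · linarith
          · rw [h2] at hdisc; nlinarith
        · exact h'
      have h1 : a0 * Q ^ 2 ≤ a0 * (P * S) := mul_le_mul_of_nonneg_left hdisc ha0.le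
      have h2 : (a0 * Q) * Q ≤ (a1 * P) * Q := by
        have : a0 * S ≤ a1 * Q := by nlinarith [mul_nonneg ha2 hP0]
        nlinarith
      exact le_of_mul_le_mul_right h2 h
  obtain ⟨f, hff⟩ : ∃ f, f = a0 + a1 * δ + a2 * δ ^ 2 := ⟨_, rfl⟩
  obtain ⟨f', hff'⟩ : ∃ f', f' = a1 + 2 * a2 * δ := ⟨_, rfl⟩
  obtain ⟨g, hgg⟩ : ∃ g, g = b0 + b1 * δ + b2 * δ ^ 2 := ⟨_, rfl⟩
  obtain ⟨g', hgg'⟩ : ∃ g', g' = b1 + 2 * b2 * δ := ⟨_, rfl⟩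
  obtain ⟨w, hw⟩ : ∃ w, w = g * f' - g' * f := ⟨_, rfl⟩
  have hw0 : 0 ≤ w := by have := hW δ; rw [hw, hff, hff', hgg, hgg']; linarith
  have hfpos : 0 < f := by rw [hff]; positivity
  have hstar : a0 * (g * f + δ * w) ≤ b0 * f ^ 2 := by
    have e : b0 * f ^ 2 - a0 * (g * f + δ * w) =
        δ ^ 2 * (a1 * P - a0 * Q + 2 * a2 * P * δ + a2 * Q * δ ^ 2) := by
      rw [hw, hff, hff', hgg, hgg', hP, hQ]; ring
    have : 0 ≤ δ ^ 2 * (a1 * P - a0 * Q + 2 * a2 * P * δ + a2 * Q * δ ^ 2) := by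
      have h1 : 0 ≤ a1 * P - a0 * Q := by linarith
      positivity
    linarith
  rw [← hff, ← hff', ← hgg, ← hgg']
  rw [← hff, ← hff'] at hf
  have hstar2 : g * f + δ * w ≤ φ * f ^ 2 := by
    have : a0 * (g * f + δ * w) ≤ a0 * (φ * f ^ 2) := by
      have := mul_le_mul_of_nonneg_right hb (sq_nonneg f)
      linarith
    exact le_of_mul_le_mul_left this ha0
  have hE : (1 - φ) * f ≤ f - f' / 2 := by linarith
  have hE0 : 0 ≤ f - f' / 2 := le_trans (by have : 0 < 1 - φ := by linarith
                                            positivity) hE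
  have h1 : f ^ 2 * (g - g' / 2) = f * g * (f - f' / 2) + f * w / 2 := by rw [hw]; ring
  have h2 : f * w / 2 ≤ (f - f' / 2) * (δ * w) := by
    have : f * w * 1 ≤ f * w * (2 * (1 - φ) * δ) := mul_le_mul_of_nonneg_left hd (by positivity)
    have h3 : (1 - φ) * f * (δ * w) ≤ (f - f' / 2) * (δ * w) :=
      mul_le_mul_of_nonneg_right hE (by positivity)
    nlinarith
  have h3 : (f - f' / 2) * (g * f + δ * w) ≤ (f - f' / 2) * (φ * f ^ 2) :=
    mul_le_mul_of_nonneg_left hstar2 hE0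
  have h4 : f ^ 2 * (g - g' / 2) ≤ f ^ 2 * (φ * (f - f' / 2)) := by
    rw [h1]; linarith
  exact le_of_mul_le_mul_left h4 (by positivity)

lemma barrier {σ : Type*} [Fintype σ] [DecidableEq σ] {f : (σ → ℝ) → ℝ} (hf : RS f) {i j : σ}
    {x : σ → ℝ} (hx : Ab f x) {φ δ : ℝ} (hφ : φ < 1) (hδ : 0 < δ)
    (hd : 1 ≤ 2 * (1 - φ) * δ) (hi : pd f i x ≤ φ * f x) (hj : pd f j x ≤ φ * f x) :
    Ab (Ex i j f) (x + Pi.single i δ + Pi.single j δ) ∧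
    ∀ k, k ≠ i → k ≠ j → pd f k x ≤ φ * f x →
      pd (Ex i j f) k (x + Pi.single i δ + Pi.single j δ) ≤
        φ * Ex i j f (x + Pi.single i δ + Pi.single j δ) := by
  have hle : x ≤ x + Pi.single i δ + Pi.single j δ :=
    (le_add_single _ _ hδ.le).trans (le_add_single _ _ hδ.le)
  refine ⟨?_, ?_⟩
  · intro y hy
    have h1 := hf.pd_le hx hi y (hle.trans hy)
    have h2 := hf.pd_le hx hj y (hle.trans hy)
    have h3 := hx y (hle.trans hy)
    rw [hf.1.ex_eq]
    nlinarith
  · intro k hki hkj hk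
    have hg := hf.1.pd_aff k
    have expand : ∀ g : (σ → ℝ) → ℝ, Aff g → ∀ t : ℝ,
        g (x + Pi.single i t + Pi.single j t) =
          g x + (pd g i x + pd g j x) * t + pd (pd g j) i x * t ^ 2 ∧
        pd g i (x + Pi.single i t + Pi.single j t) + pd g j (x + Pi.single i t + Pi.single j t) =
          (pd g i x + pd g j x) + 2 * pd (pd g j) i x * t := by
      intro g hg t
      constructor
      · rw [hg.two]; ring
      · rw [hg.pd_self, (hg.pd_aff i), hg.pd_self, hg.pd_aff j, pd_comm g i j,
          (hg.pd_aff j).pd_self]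
        ring
    rw [pd_ex, hf.1.ex_eq, hg.ex_eq, (expand f hf.1 δ).1, (expand f hf.1 δ).2,
      (expand _ hg δ).1, (expand _ hg δ).2]
    refine barrier_alg (hx x le_rfl)
      (add_nonneg (hx.pd_nonneg hf.1 i) (hx.pd_nonneg hf.1 j)) ?_ ?_ hφ hδ hd hk ?_
    ·
      by_contra hcon
      push Not at hcon
      set a2 := pd (pd f j) i x with ha2
      have : ∀ t, 0 ≤ t → 0 ≤ pd f j x + t * a2 := by
        intro t ht
        have := (hx.mono (le_add_single x i ht)).pd_nonneg hf.1 j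
        rwa [hf.1.pd_aff j] at this
      have h0 := this 0 le_rfl
      simp at h0
      have := this ((pd f j x + 1) / (-a2)) (div_nonneg (by linarith) (by linarith))
      have hne : a2 ≠ 0 := hcon.ne
      have e : (pd f j x + 1) / (-a2) * a2 = - (pd f j x + 1) := by field_simp
      rw [e] at this
      linarith
    · intro t
      have r1 := hf.ray hki (x + Pi.single i t + Pi.single j t)
      have r2 := hf.ray hkj (x + Pi.single i t + Pi.single j t)
      rw [← (expand f hf.1 t).1, ← (expand f hf.1 t).2,
        ← (expand _ hg t).1, ← (expand _ hg t).2]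
      nlinarith
    · have h1 := hf.pd_le hx hi _ hle
      have h2 := hf.pd_le hx hj _ hle
      rw [← (expand f hf.1 δ).1, ← (expand f hf.1 δ).2]
      linarith

end ThinBasis

namespace ThinBasis
open Matrix

/-- iterated averaging operator -/
def avg {τ ι : Type*} [DecidableEq τ] [DecidableEq ι] :
    List ι → ((τ ⊕ (ι × Bool) → ℝ) → ℝ) → ((τ ⊕ (ι × Bool) → ℝ) → ℝ)
  | [], f => f
  | i :: L, f => Ex (Sum.inr (i, true)) (Sum.inr (i, false)) (avg L f)

lemma RS.avg {τ ι : Type*} [DecidableEq τ] [DecidableEq ι] {f : (τ ⊕ (ι × Bool) → ℝ) → ℝ}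
    (hf : RS f) (L : List ι) : RS (avg L f) := by
  induction L with
  | nil => exact hf
  | cons i L ih => exact ih.ex _ _

lemma barrier_list {τ ι : Type*} [Fintype τ] [Fintype ι] [DecidableEq τ] [DecidableEq ι]
    {f : (τ ⊕ (ι × Bool) → ℝ) → ℝ} (hf : RS f) {x : τ ⊕ (ι × Bool) → ℝ} (hx : Ab f x) {φ δ : ℝ}
    (hφ : φ < 1) (hδ : 0 < δ) (hd : 1 ≤ 2 * (1 - φ) * δ)
    (hk : ∀ k, pd f (Sum.inr k) x ≤ φ * f x) (L : List ι) (hL : L.Nodup) :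
    ∃ y : τ ⊕ (ι × Bool) → ℝ, (∀ a, y (Sum.inl a) = x (Sum.inl a)) ∧
      (∀ k, y (Sum.inr k) = x (Sum.inr k) + if k.1 ∈ L then δ else 0) ∧
      Ab (avg L f) y ∧ ∀ k : ι × Bool, k.1 ∉ L → pd (avg L f) (Sum.inr k) y ≤ φ * avg L f y := by
  induction L with
  | nil => exact ⟨x, by simp, by simp, hx, fun k _ => hk k⟩
  | cons i L ih =>
    rw [List.nodup_cons] at hL
    obtain ⟨y, h1, h2, h3, h4⟩ := ih hL.2
    have hb := barrier (hf.avg L) h3 hφ hδ hd (h4 (i, true) hL.1) (h4 (i, false) hL.1)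
    refine ⟨_, ?_, ?_, hb.1, ?_⟩
    · intro a; simp [h1]
    · rintro ⟨l, b⟩
      by_cases hl : l = i
      · subst hl
        cases b <;> simp [h2, hL.1, Pi.single_apply]
      · cases b <;> simp [h2, hl, Pi.single_apply]
    · rintro ⟨l, b⟩ hl
      simp only [List.mem_cons, not_or] at hl
      refine hb.2 (Sum.inr (l, b)) ?_ ?_ (h4 _ hl.2)
      · simp [hl.1]
      · simp [hl.1]

lemma choice_list {τ ι : Type*} [Fintype τ] [Fintype ι] [DecidableEq τ] [DecidableEq ι]
    {f : (τ ⊕ (ι × Bool) → ℝ) → ℝ} (hf : RS f) (L : List ι) (hL : L.Nodup) :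
    ∀ x : τ ⊕ (ι × Bool) → ℝ, Ab (avg L f) x → ∃ c : ι → Bool, ∃ y : τ ⊕ (ι × Bool) → ℝ,
      (∀ a, y (Sum.inl a) = x (Sum.inl a)) ∧
      (∀ k, y (Sum.inr k) = x (Sum.inr k) - if k.1 ∈ L ∧ c k.1 = k.2 then 1 else 0) ∧
      Ab f y := by
  induction L with
  | nil => intro x hx; exact ⟨fun _ => true, x, by simp, by simp, hx⟩
  | cons i L ih =>
    rw [List.nodup_cons] at hL
    intro x hx
    have gen : ∀ b : Bool, Ab (avg L f) (x - Pi.single (Sum.inr (i, b)) 1) →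
        ∃ c : ι → Bool, ∃ y : τ ⊕ (ι × Bool) → ℝ,
        (∀ a, y (Sum.inl a) = x (Sum.inl a)) ∧
        (∀ k, y (Sum.inr k) = x (Sum.inr k) - if k.1 ∈ i :: L ∧ c k.1 = k.2 then 1 else 0) ∧
        Ab f y := by
      intro b hb
      obtain ⟨c, y, h1, h2, h3⟩ := ih hL.2 _ hb
      refine ⟨Function.update c i b, y, ?_, ?_, h3⟩
      · intro a; simp [h1]
      · rintro ⟨l, b'⟩
        by_cases hl : l = i
        · subst hl
          cases b <;> cases b' <;> simp [h2, hL.1, Pi.single_apply]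
        · cases b <;> cases b' <;> simp [h2, hl, Pi.single_apply]
    rcases choice (hf.avg L) hx with h | h
    · exact gen true h
    · exact gen false h

lemma det_affine {n R : Type*} [Fintype n] [DecidableEq n] [CommRing R] (A : Matrix n n R)
    (u v : n → R) (t : R) : (A + t • vecMulVec u v).det =
      A.det + t * ((A + vecMulVec u v).det - A.det) := by
  have key : ∀ t : R, (A + t • vecMulVec u v).det =
      (Matrix.updateRow (fromBlocks (1 : Matrix Unit Unit R) 0 (replicateCol Unit u) A) (Sum.inl ())
        (Sum.elim (fun _ => (1:R)) 0 + t • Sum.elim (fun _ => (0:R)) (-v))).det := by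
    intro t
    have e : Matrix.updateRow (fromBlocks (1 : Matrix Unit Unit R) 0 (replicateCol Unit u) A)
        (Sum.inl ())
        (Sum.elim (fun _ => (1:R)) 0 + t • Sum.elim (fun _ => (0:R)) (-v)) =
        fromBlocks (1 : Matrix Unit Unit R) (replicateRow Unit (-(t • v))) (replicateCol Unit u) A := by
      ext i j
      rcases i with i | i <;> rcases j with j | j <;> simp [Matrix.updateRow_apply]
    rw [e, det_fromBlocks_one₁₁]
    congr 1
    ext i j
    simp [Matrix.mul_apply, vecMulVec_apply]
    ring
  have h1 := key 1
  rw [one_smul] at h1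
  have h0 := key 0
  rw [zero_smul, add_zero] at h0
  rw [h1, h0, key t]
  simp only [det_updateRow_add, det_updateRow_smul]
  ring

/-- weighted sum of rank-one matrices -/
def WS {n σ R : Type*} [Fintype σ] [CommRing R] (r : σ → n → R) (y : σ → R) : Matrix n n R :=
  ∑ k, y k • vecMulVec (r k) (r k)

lemma WS_add_single {n σ R : Type*} [Fintype σ] [DecidableEq σ] [CommRing R] (r : σ → n → R)
    (y : σ → R) (i : σ) (t : R) :
    WS r (y + Pi.single i t) = WS r y + t • vecMulVec (r i) (r i) := by
  unfold WS
  simp only [Pi.add_apply, add_smul, Finset.sum_add_distrib]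
  congr 1
  rw [Finset.sum_eq_single i]
  · simp
  · intro b _ hb; simp [Pi.single_eq_of_ne hb]
  · simp

lemma WS_aff {n σ R : Type*} [Fintype n] [DecidableEq n] [Fintype σ] [DecidableEq σ] [CommRing R]
    (r : σ → n → R) : Aff (fun y => (WS r y).det) := by
  intro y i t
  simp only [pd, WS_add_single, one_smul]
  exact det_affine _ _ _ _

lemma WS_mulVec {n σ R : Type*} [Fintype n] [Fintype σ] [CommRing R]
    (r : σ → n → R) (y : σ → R) (v : n → R) :
    WS r y *ᵥ v = ∑ k, (y k * (r k ⬝ᵥ v)) • r k := by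
  unfold WS
  rw [Matrix.sum_mulVec]
  refine Finset.sum_congr rfl fun k _ => ?_
  rw [Matrix.smul_mulVec, Matrix.vecMulVec_mulVec]
  ext i
  simp
  ring

lemma WS_qf {n σ R : Type*} [Fintype n] [Fintype σ] [CommRing R]
    (r : σ → n → R) (y : σ → R) (w v : n → R) :
    w ⬝ᵥ (WS r y *ᵥ v) = ∑ k, y k * (r k ⬝ᵥ v) * (r k ⬝ᵥ w) := by
  rw [WS_mulVec, dotProduct_sum]
  refine Finset.sum_congr rfl fun k _ => ?_
  rw [dotProduct_smul, smul_eq_mul, dotProduct_comm w]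

lemma WS_herm {n σ : Type*} [Fintype σ] (r : σ → n → ℝ) (y : σ → ℝ) : (WS r y).IsHermitian := by
  ext i j
  simp [WS, Matrix.sum_apply, vecMulVec_apply, mul_comm]

lemma WS_rs {n σ : Type*} [Fintype n] [DecidableEq n] [Fintype σ] [DecidableEq σ]
    (r : σ → n → ℝ) (hr : ∀ v : n → ℝ, (∀ k, r k ⬝ᵥ v = 0) → v = 0) :
    RS (fun y => (WS r y).det) := by
  let rc : σ → n → ℂ := fun k i => (r k i : ℂ)
  refine ⟨WS_aff r, fun z => (WS rc z).det, WS_aff rc, ?_, ?_, ?_⟩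
  · intro z hz h0
    obtain ⟨v, hv, hv0⟩ := Matrix.exists_mulVec_eq_zero_iff.mpr h0
    have h1 := WS_qf rc z (star v) v
    rw [hv0, dotProduct_zero] at h1
    have h2 : ∀ k, rc k ⬝ᵥ star v = (starRingEnd ℂ) (rc k ⬝ᵥ v) := by
      intro k
      simp [dotProduct, rc]
    have h3 : ∑ k, (z k).im * Complex.normSq (rc k ⬝ᵥ v) = 0 := by
      have := congrArg Complex.im h1
      simp only [h2, mul_assoc, Complex.mul_conj, Complex.im_sum, Complex.zero_im,
        Complex.im_mul_ofReal] at this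
      exact this.symm
    have h4 : ∀ k, rc k ⬝ᵥ v = 0 := by
      intro k
      have := (Finset.sum_eq_zero_iff_of_nonneg (fun k _ =>
        mul_nonneg (hz k).le (Complex.normSq_nonneg _))).mp h3 k (Finset.mem_univ _)
      rcases mul_eq_zero.mp this with h | h
      · exact absurd h (hz k).ne'
      · exact Complex.normSq_eq_zero.mp h
    have hre : (fun i => (v i).re) = 0 := by
      apply hr
      intro k
      have := congrArg Complex.re (h4 k)
      simpa [dotProduct, rc] using this
    have him : (fun i => (v i).im) = 0 := by
      apply hr
      intro k
      have := congrArg Complex.im (h4 k)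
      simpa [dotProduct, rc] using this
    apply hv
    ext i
    exact Complex.ext (congrFun hre i) (congrFun him i)
  · refine Continuous.matrix_det ?_
    unfold WS
    exact continuous_finsetSum _ fun k _ => (continuous_apply k).smul continuous_const
  · intro x
    have : WS rc (fun k => (x k : ℂ)) = (WS r x).map (algebraMap ℝ ℂ) := by
      ext i j
      simp [WS, Matrix.sum_apply, vecMulVec_apply, rc]
    show (WS rc (fun k => (x k : ℂ))).det = (((WS r x).det : ℝ) : ℂ)
    rw [this]
    exact (RingHom.map_det (algebraMap ℝ ℂ) (WS r x)).symm

lemma det_rank_one {n : Type*} [Fintype n] [DecidableEq n] {M : Matrix n n ℝ} (hM : M.PosDef)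
    (r : n → ℝ) : (M + vecMulVec r r).det = M.det * (1 + r ⬝ᵥ (M⁻¹ *ᵥ r)) := by
  have h := Matrix.det_add_replicateCol_mul_replicateRow (ι := Unit)
    ((Matrix.isUnit_iff_isUnit_det _).mp hM.isUnit) r r
  rw [← Matrix.vecMulVec_eq] at h
  rw [h]
  congr 1
  simp [Matrix.det_unique, Matrix.mul_apply, dotProduct, mulVec, Finset.sum_mul, Finset.mul_sum]
  rw [Finset.sum_comm]
  refine Finset.sum_congr rfl fun i _ => Finset.sum_congr rfl fun j _ => by ring

lemma posSemidef_of_det {n : Type*} [Fintype n] [DecidableEq n] {B : Matrix n n ℝ}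
    (hB : B.IsHermitian) (h : ∀ t : ℝ, 0 ≤ t → 0 < (B + t • (1 : Matrix n n ℝ)).det) :
    B.PosSemidef := by
  rw [hB.posSemidef_iff_eigenvalues_nonneg]
  intro j
  by_contra hcon
  have hcon' : hB.eigenvalues j < 0 := not_le.mp hcon
  have h1 := h (-hB.eigenvalues j) (by linarith)
  have h2 : (B + (-hB.eigenvalues j) • (1 : Matrix n n ℝ)).det = 0 := by
    rw [← Matrix.exists_mulVec_eq_zero_iff]
    refine ⟨hB.eigenvectorBasis j, ?_, ?_⟩
    · intro h0
      have : hB.eigenvectorBasis j = 0 := by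
        ext i; exact congrFun h0 i
      have h3 := hB.eigenvectorBasis.orthonormal.1 j
      rw [this] at h3
      simp at h3
    · rw [Matrix.add_mulVec, hB.mulVec_eigenvectorBasis, Matrix.smul_mulVec, Matrix.one_mulVec]
      simp
  linarith

lemma posDef_of_lower {n σ : Type*} [Fintype n] [Fintype σ] (r : σ → n → ℝ) (y : σ → ℝ) {φ : ℝ}
    (hφ : 0 < φ) (h : ∀ v : n → ℝ, φ * (v ⬝ᵥ v) ≤ ∑ k, y k * (r k ⬝ᵥ v) ^ 2) :
    (WS r y).PosDef := by
  refine Matrix.PosDef.of_dotProduct_mulVec_pos (WS_herm r y) ?_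
  intro v hv
  have h1 : star v = v := by ext; simp
  rw [h1, WS_qf]
  have h2 : 0 < v ⬝ᵥ v := by
    have := dotProduct_star_self_pos_iff.mpr hv
    rwa [h1] at this
  have h3 := h v
  have h4 : 0 < φ * (v ⬝ᵥ v) := by positivity
  calc 0 < φ * (v ⬝ᵥ v) := h4
    _ ≤ _ := h3
    _ = _ := Finset.sum_congr rfl fun k _ => by ring

lemma cs {n : Type*} [Fintype n] (a b : n → ℝ) : (a ⬝ᵥ b) ^ 2 ≤ (a ⬝ᵥ a) * (b ⬝ᵥ b) := by
  have := Finset.sum_mul_sq_le_sq_mul_sq Finset.univ a b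
  simpa [dotProduct, sq] using this

lemma dot_self_nonneg {n : Type*} [Fintype n] (a : n → ℝ) : 0 ≤ a ⬝ᵥ a :=
  Finset.sum_nonneg fun i _ => mul_self_nonneg _

lemma inv_bound {n : Type*} [Fintype n] [DecidableEq n] {M : Matrix n n ℝ} (hM : M.PosDef)
    {φ : ℝ} (hφ : 0 < φ) (h : ∀ v : n → ℝ, φ * (v ⬝ᵥ v) ≤ v ⬝ᵥ (M *ᵥ v)) (r : n → ℝ)
    (hr : r ⬝ᵥ r ≤ φ ^ 2) : r ⬝ᵥ (M⁻¹ *ᵥ r) ≤ φ := by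
  set w := M⁻¹ *ᵥ r with hw
  have hMw : M *ᵥ w = r := by
    rw [hw, Matrix.mulVec_mulVec, Matrix.mul_nonsing_inv _ ((Matrix.isUnit_iff_isUnit_det _).mp hM.isUnit),
      Matrix.one_mulVec]
  have h1 := h w
  rw [hMw, dotProduct_comm w r] at h1
  have h2 := cs r w
  have hw0 := dot_self_nonneg w
  by_contra hcon
  push Not at hcon
  have h3 : (r ⬝ᵥ w) ^ 2 ≤ φ ^ 2 * (w ⬝ᵥ w) := h2.trans (mul_le_mul_of_nonneg_right hr hw0)
  have h1' : φ * (w ⬝ᵥ w) ≤ r ⬝ᵥ w := h1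
  nlinarith [mul_le_mul_of_nonneg_left h1' hφ.le]

theorem halve {n ι : Type*} [Fintype n] [DecidableEq n] [Fintype ι] [DecidableEq ι]
    (u : ι → n → ℝ) {φ : ℝ} (hφ : 0 < φ) (hφ2 : φ ≤ 1 / 2) (hu : ∀ i, u i ⬝ᵥ u i ≤ φ ^ 2)
    (hM : ∀ x : n → ℝ, ∑ i, (u i ⬝ᵥ x) ^ 2 ≤ x ⬝ᵥ x) :
    ∃ c : ι → Bool, ∀ b : Bool, ∀ x : n → ℝ, ∑ i, (if c i = b then (u i ⬝ᵥ x) ^ 2 else 0) ≤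
      (∑ i, (u i ⬝ᵥ x) ^ 2) / 2 + 2 * φ * (x ⬝ᵥ x) := by
  let r : (n ⊕ n) ⊕ (ι × Bool) → (n ⊕ n) → ℝ := Sum.elim (fun l => Pi.single l 1)
    (fun k => if k.2 then Sum.elim (u k.1) 0 else Sum.elim 0 (u k.1))
  have hrs : RS (fun y => (WS r y).det) := by
    apply WS_rs
    intro v hv
    ext l
    have := hv (Sum.inl l)
    simpa [r] using this
  obtain ⟨δ, hδ⟩ : ∃ δ, δ = 1 / (2 * (1 - φ)) := ⟨_, rfl⟩
  have h1φ : 0 < 1 - φ := by linarith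
  have hδ0 : 0 < δ := by rw [hδ]; positivity
  have hd : 1 ≤ 2 * (1 - φ) * δ := by rw [hδ]; field_simp; rfl
  have hδφ : δ - 1 / 2 ≤ φ := by
    rw [hδ, sub_le_iff_le_add, div_le_iff₀ (by positivity)]
    nlinarith
  have hδh : 0 ≤ δ - 1 / 2 := by
    rw [hδ, sub_nonneg, div_le_div_iff₀ (by norm_num) (by positivity)]
    linarith
  let x0 : (n ⊕ n) ⊕ (ι × Bool) → ℝ := Sum.elim (fun _ => 2 * φ) (fun _ => 1 / 2 - δ)
  have split : ∀ (y : (n ⊕ n) ⊕ (ι × Bool) → ℝ) (v : n ⊕ n → ℝ),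
      ∑ k, y k * (r k ⬝ᵥ v) ^ 2 = ∑ l, y (Sum.inl l) * (v l) ^ 2 +
        (∑ i, y (Sum.inr (i, true)) * (u i ⬝ᵥ (v ∘ Sum.inl)) ^ 2 +
         ∑ i, y (Sum.inr (i, false)) * (u i ⬝ᵥ (v ∘ Sum.inr)) ^ 2) := by
    intro y v
    rw [Fintype.sum_sum_type]
    congr 1
    · simp [r]
    · rw [Fintype.sum_prod_type, ← Finset.sum_add_distrib]
      refine Finset.sum_congr rfl fun i _ => ?_
      simp [r, dotProduct, Fintype.sum_sum_type]
  have vv : ∀ v : n ⊕ n → ℝ, v ⬝ᵥ v = (v ∘ Sum.inl) ⬝ᵥ (v ∘ Sum.inl) + (v ∘ Sum.inr) ⬝ᵥ (v ∘ Sum.inr) := by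
    intro v; simp [dotProduct, Fintype.sum_sum_type]
  have low0 : ∀ v : n ⊕ n → ℝ, φ * (v ⬝ᵥ v) ≤ ∑ k, x0 k * (r k ⬝ᵥ v) ^ 2 := by
    intro v
    rw [split]
    simp only [x0, Sum.elim_inl, Sum.elim_inr, ← Finset.mul_sum]
    have e : ∑ l, v l ^ 2 = v ⬝ᵥ v := by simp [dotProduct, sq]
    rw [e]
    have h1 := hM (v ∘ Sum.inl)
    have h2 := hM (v ∘ Sum.inr)
    have h3 := vv v
    have h4 := dot_self_nonneg v
    nlinarith [mul_le_mul_of_nonneg_left (add_le_add h1 h2) hδh, mul_le_mul_of_nonneg_right hδφ h4]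
  have low : ∀ y, x0 ≤ y → ∀ v : n ⊕ n → ℝ, φ * (v ⬝ᵥ v) ≤ ∑ k, y k * (r k ⬝ᵥ v) ^ 2 := by
    intro y hy v
    refine (low0 v).trans (Finset.sum_le_sum fun k _ => ?_)
    exact mul_le_mul_of_nonneg_right (hy k) (sq_nonneg _)
  have hAb : Ab (fun y => (WS r y).det) x0 := by
    intro y hy
    exact (posDef_of_lower r y hφ (low y hy)).det_pos
  have hpd : ∀ k, pd (fun y => (WS r y).det) (Sum.inr k) x0 ≤ φ * (WS r x0).det := by
    intro k
    have hP := posDef_of_lower r x0 hφ low0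
    simp only [pd, WS_add_single, one_smul]
    rw [det_rank_one hP]
    have hb := inv_bound hP hφ (fun v => by
      rw [WS_qf]
      refine (low0 v).trans (le_of_eq (Finset.sum_congr rfl fun k _ => by ring))) (r (Sum.inr k)) (by
      rcases k with ⟨i, b⟩
      cases b <;> simpa [r, dotProduct, Fintype.sum_sum_type] using hu i)
    have := mul_le_mul_of_nonneg_left hb hP.det_pos.le
    linarith
  obtain ⟨y, y1, y2, y3, -⟩ := barrier_list hrs hAb (by linarith) hδ0 hd hpd
    (Finset.univ.toList) (Finset.nodup_toList _)
  obtain ⟨c, z, z1, z2, z3⟩ := choice_list hrs _ (Finset.nodup_toList _) y y3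
  have hz1 : ∀ a, z (Sum.inl a) = 2 * φ := by intro a; rw [z1, y1]; rfl
  have hz2 : ∀ i b, z (Sum.inr (i, b)) = 1 / 2 - if c i = b then 1 else 0 := by
    intro i b; rw [z2, y2]; simp [x0]
  have hpsd : (WS r z).PosSemidef := by
    refine posSemidef_of_det (WS_herm r z) ?_
    intro t ht
    let z' : (n ⊕ n) ⊕ (ι × Bool) → ℝ := z + Sum.elim (fun _ => t) 0
    have e : WS r z' = WS r z + t • (1 : Matrix (n ⊕ n) (n ⊕ n) ℝ) := by
      simp only [WS, z', Pi.add_apply, add_smul, Finset.sum_add_distrib]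
      congr 1
      rw [Fintype.sum_sum_type]
      simp only [Sum.elim_inl, Sum.elim_inr, Pi.zero_apply, zero_smul, Finset.sum_const_zero,
        add_zero, ← Finset.smul_sum]
      congr 1
      ext a b
      simp only [r, Sum.elim_inl, Matrix.sum_apply, vecMulVec_apply, Pi.single_apply,
        Matrix.one_apply]
      simp
    rw [← e]
    refine z3 z' ?_
    refine le_add_of_nonneg_right ?_
    intro k
    rcases k with k | k <;> simp [ht]
  have hq : ∀ v : n ⊕ n → ℝ, 0 ≤ ∑ k, z k * (r k ⬝ᵥ v) ^ 2 := by
    intro v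
    have := hpsd.dotProduct_mulVec_nonneg v
    have h1 : star v = v := by ext; simp
    rw [h1, WS_qf] at this
    refine this.trans (le_of_eq (Finset.sum_congr rfl fun k _ => by ring))
  refine ⟨c, ?_⟩
  have fin : ∀ (b : Bool) (x : n → ℝ),
      0 ≤ 2 * φ * (x ⬝ᵥ x) + ∑ i, (1 / 2 - if c i = b then 1 else 0) * (u i ⬝ᵥ x) ^ 2 →
      ∑ i, (if c i = b then (u i ⬝ᵥ x) ^ 2 else 0) ≤
      (∑ i, (u i ⬝ᵥ x) ^ 2) / 2 + 2 * φ * (x ⬝ᵥ x) := by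
    intro b x h
    have e : ∑ i, (1 / 2 - if c i = b then (1:ℝ) else 0) * (u i ⬝ᵥ x) ^ 2 =
        (∑ i, (u i ⬝ᵥ x) ^ 2) / 2 - ∑ i, (if c i = b then (u i ⬝ᵥ x) ^ 2 else 0) := by
      rw [Finset.sum_div, ← Finset.sum_sub_distrib]
      refine Finset.sum_congr rfl fun i _ => ?_
      split_ifs <;> ring
    rw [e] at h
    linarith
  intro b x
  apply fin
  cases b
  · have := hq (Sum.elim 0 x)
    rw [split] at this
    simp only [hz1, hz2, ← Finset.mul_sum, Sum.elim_comp_inl, Sum.elim_comp_inr] at this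
    simpa [dotProduct, Fintype.sum_sum_type, sq] using this
  · have := hq (Sum.elim x 0)
    rw [split] at this
    simp only [hz1, hz2, ← Finset.mul_sum, Sum.elim_comp_inl, Sum.elim_comp_inr] at this
    simpa [dotProduct, Fintype.sum_sum_type, sq] using this

end ThinBasis

namespace ThinBasis
open Matrix

lemma le_of_sq_le_sq_aux {a b : ℝ} (h : a ^ 2 ≤ b ^ 2) (hb : 0 ≤ b) : a ≤ b :=
  (abs_le_of_sq_le_sq' h hb).2

lemma halve_step {n ι : Type*} [Fintype n] [DecidableEq n] [Fintype ι] [DecidableEq ι]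
    (u : ι → n → ℝ) (S : Finset ι) {φ s : ℝ} (hφ : 0 < φ) (hφ2 : φ ≤ 1 / 2) (hs : 0 < s)
    (hu : ∀ i, u i ⬝ᵥ u i ≤ φ ^ 2 * s ^ 2)
    (hM : ∀ x : n → ℝ, ∑ i ∈ S, (u i ⬝ᵥ x) ^ 2 ≤ s ^ 2 * (x ⬝ᵥ x)) :
    ∃ S' : Finset ι, ∀ x : n → ℝ,
      |∑ i ∈ S', (u i ⬝ᵥ x) ^ 2 - (∑ i ∈ S, (u i ⬝ᵥ x) ^ 2) / 2| ≤
        2 * φ * s ^ 2 * (x ⬝ᵥ x) := by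
  let u' : ι → n → ℝ := fun i => if i ∈ S then s⁻¹ • u i else 0
  have e0 : ∀ i x, (u' i ⬝ᵥ x) ^ 2 = if i ∈ S then (u i ⬝ᵥ x) ^ 2 / s ^ 2 else 0 := by
    intro i x
    by_cases h : i ∈ S
    · simp only [u', h, if_true, smul_dotProduct, smul_eq_mul]
      field_simp
    · simp [u', h]
  have e1 : ∀ x, ∑ i, (u' i ⬝ᵥ x) ^ 2 = (∑ i ∈ S, (u i ⬝ᵥ x) ^ 2) / s ^ 2 := by
    intro x
    simp only [e0, Finset.sum_div, Finset.sum_ite_mem, Finset.univ_inter]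
  have hs2 : 0 < s ^ 2 := by positivity
  obtain ⟨c, hc⟩ := halve u' hφ hφ2 (by
    intro i
    by_cases h : i ∈ S
    · simp only [u', h, if_true, smul_dotProduct, dotProduct_smul, smul_eq_mul]
      have : s⁻¹ * (s⁻¹ * (u i ⬝ᵥ u i)) = (u i ⬝ᵥ u i) / s ^ 2 := by field_simp
      rw [this, div_le_iff₀ hs2]
      exact hu i
    · simp only [u', h, if_false, dotProduct_zero]
      positivity) (by
    intro x
    rw [e1, div_le_iff₀ hs2, mul_comm]
    exact hM x)
  refine ⟨S.filter (fun i => c i = true), fun x => ?_⟩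
  have e2 : ∀ b, ∑ i, (if c i = b then (u' i ⬝ᵥ x) ^ 2 else 0) =
      (∑ i ∈ S.filter (fun i => c i = b), (u i ⬝ᵥ x) ^ 2) / s ^ 2 := by
    intro b
    rw [Finset.sum_filter, Finset.sum_div]
    rw [← Finset.sum_subset (Finset.subset_univ S)]
    · refine Finset.sum_congr rfl fun i hi => ?_
      rw [e0, if_pos hi]
      split_ifs <;> simp
    · intro i _ hi
      rw [e0, if_neg hi]
      simp
  have e3 : ∑ i ∈ S.filter (fun i => c i = true), (u i ⬝ᵥ x) ^ 2 +
      ∑ i ∈ S.filter (fun i => c i = false), (u i ⬝ᵥ x) ^ 2 = ∑ i ∈ S, (u i ⬝ᵥ x) ^ 2 := by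
    rw [← Finset.sum_filter_add_sum_filter_not S (fun i => c i = true)]
    simp
  have h1 := hc true x
  have h2 := hc false x
  rw [e2, e1, div_le_iff₀ hs2] at h1 h2
  have e4 : ∀ Z : ℝ, (Z / s ^ 2 / 2 + 2 * φ * (x ⬝ᵥ x)) * s ^ 2 =
    Z / 2 + 2 * φ * s ^ 2 * (x ⬝ᵥ x) := by intro Z; field_simp
  rw [e4] at h1 h2
  rw [abs_le]
  constructor <;> linarith

lemma iterate_halve {n ι : Type*} [Fintype n] [DecidableEq n] [Fintype ι] [DecidableEq ι]
    (u : ι → n → ℝ) {η : ℝ} (hη : 0 < η) (hu : ∀ i, u i ⬝ᵥ u i ≤ η)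
    (hM : ∀ x : n → ℝ, ∑ i, (u i ⬝ᵥ x) ^ 2 ≤ 2 * (x ⬝ᵥ x)) (j : ℕ) :
    ∀ t : ℝ, t = (1 / 2) ^ j → 1600 * η ≤ t →
    ∃ S : Finset ι, ∀ x : n → ℝ,
      |∑ i ∈ S, (u i ⬝ᵥ x) ^ 2 - t * ∑ i, (u i ⬝ᵥ x) ^ 2| ≤ 20 * √(η * t) * (x ⬝ᵥ x) := by
  induction j with
  | zero =>
    intro t ht _
    refine ⟨Finset.univ, fun x => ?_⟩
    have := dot_self_nonneg x
    simp only [ht, pow_zero, one_mul, sub_self, abs_zero]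
    positivity
  | succ j ih =>
    intro t ht h
    have ht0 : 0 < t := by rw [ht]; positivity
    obtain ⟨S, hS⟩ := ih (2 * t) (by rw [ht, pow_succ]; ring) (by linarith)
    set e := √(η * (2 * t)) with he
    have he0 : 0 ≤ e := Real.sqrt_nonneg _
    have he2 : e ^ 2 = η * (2 * t) := Real.sq_sqrt (by positivity)
    set s := √(6 * t) with hs
    have hs0 : 0 < s := Real.sqrt_pos.mpr (by positivity)
    have hs2 : s ^ 2 = 6 * t := Real.sq_sqrt (by positivity)
    set φ := √(η / (6 * t)) with hφ
    have hφ0 : 0 < φ := Real.sqrt_pos.mpr (by positivity)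
    have hφ2 : φ ^ 2 = η / (6 * t) := Real.sq_sqrt (by positivity)
    have hφh : φ ≤ 1 / 2 := by
      have : φ ^ 2 ≤ (1 / 2) ^ 2 := by
        rw [hφ2, div_le_iff₀ (by positivity)]
        linarith
      exact le_of_sq_le_sq_aux this (by norm_num)
    have het : 20 * e ≤ 2 * t := by
      have : (20 * e) ^ 2 ≤ (2 * t) ^ 2 := by nlinarith
      exact le_of_sq_le_sq_aux this (by positivity)
    have hprod : φ ^ 2 * s ^ 2 = η := by rw [hφ2, hs2]; field_simp
    obtain ⟨S', hS'⟩ := halve_step u S hφ0 hφh hs0 (by rw [hprod]; exact hu) (by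
      intro x
      have h1 := (abs_le.mp (hS x)).2
      have h2 := hM x
      have h3 := dot_self_nonneg x
      rw [hs2]
      nlinarith [mul_le_mul_of_nonneg_right het h3, mul_le_mul_of_nonneg_left h2 ht0.le])
    refine ⟨S', fun x => ?_⟩
    have h3 := dot_self_nonneg x
    have k1 := abs_le.mp (hS' x)
    have k2 := abs_le.mp (hS x)
    set e' := √(η * t) with he'
    have he0' : 0 ≤ e' := Real.sqrt_nonneg _
    have he2' : e' ^ 2 = η * t := Real.sq_sqrt (by positivity)
    have c1 : 10 * e + 2 * φ * s ^ 2 ≤ 20 * e' := by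
      have a1 : e ≤ 1.42 * e' := le_of_sq_le_sq_aux (by nlinarith) (by positivity)
      have a2 : φ * s ^ 2 ≤ 2.45 * e' := by
        refine le_of_sq_le_sq_aux ?_ (by positivity)
        have : (φ * s ^ 2) ^ 2 = (φ ^ 2 * s ^ 2) * s ^ 2 := by ring
        rw [this, hprod, hs2]
        nlinarith [mul_pos hη ht0]
      linarith
    have c2 := mul_le_mul_of_nonneg_right c1 h3
    rw [abs_le]
    constructor <;> nlinarith

end ThinBasis

namespace ThinBasis
open Matrix

lemma posDef_add_rank_one {n : Type*} [Fintype n] [DecidableEq n] {N : Matrix n n ℝ}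
    (hN : N.PosDef) {c : ℝ} (hc : 0 ≤ c) (r : n → ℝ) :
    (N + c • vecMulVec r r).PosDef ∧ N.det ≤ (N + c • vecMulVec r r).det := by
  have h1 : c • vecMulVec r r = vecMulVec (√c • r) (√c • r) := by
    ext i j
    simp only [Matrix.smul_apply, vecMulVec_apply, Pi.smul_apply, smul_eq_mul]
    have := Real.mul_self_sqrt hc
    linear_combination (-(r i * r j)) * this
  rw [h1]
  constructor
  · have := Matrix.posSemidef_vecMulVec_self_star (√c • r)
    have hs : star (√c • r) = √c • r := by ext; simp
    rw [hs] at this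
    exact hN.add_posSemidef this
  · rw [det_rank_one hN]
    have h2 : 0 ≤ (√c • r) ⬝ᵥ (N⁻¹ *ᵥ (√c • r)) := by
      have := hN.inv.posSemidef.dotProduct_mulVec_nonneg (√c • r)
      have hs : star (√c • r) = √c • r := by ext; simp
      rwa [hs] at this
    nlinarith [mul_nonneg hN.det_pos.le h2]

lemma posDef_add_sum {n σ : Type*} [Fintype n] [DecidableEq n] [DecidableEq σ] {N : Matrix n n ℝ}
    (hN : N.PosDef) (c : σ → ℝ) (hc : ∀ k, 0 ≤ c k) (r : σ → n → ℝ) (s : Finset σ) :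
    (N + ∑ k ∈ s, c k • vecMulVec (r k) (r k)).PosDef ∧
      N.det ≤ (N + ∑ k ∈ s, c k • vecMulVec (r k) (r k)).det := by
  induction s using Finset.induction_on with
  | empty => simpa using hN
  | insert a s ha ih =>
    rw [Finset.sum_insert ha, add_comm (c a • _), ← add_assoc]
    have := posDef_add_rank_one ih.1 (hc a) (r a)
    exact ⟨this.1, ih.2.trans this.2⟩

lemma WS_lower {n : Type*} [Fintype n] [DecidableEq n] {k : ℕ} (r : Fin k × n → n → ℝ)
    (hr : ∀ a, (Matrix.of fun j => r (a, j)).det ≠ 0) (a : Fin k) (lam : Fin k × n → ℝ)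
    (hl : ∀ p, 0 < lam p) :
    (WS r lam).PosDef ∧
      (∏ j, lam (a, j)) * (Matrix.of fun j => r (a, j)).det ^ 2 ≤ (WS r lam).det := by
  set Q : Matrix n n ℝ := Matrix.of fun j => r (a, j) with hQ
  let N : Matrix n n ℝ := WS (fun j => r (a, j)) (fun j => lam (a, j))
  have hN1 : N = Qᵀ * (Matrix.diagonal (fun j => lam (a, j)) * Q) := by
    ext i j
    rw [Matrix.mul_apply]
    simp only [N, WS, Matrix.sum_apply, Matrix.smul_apply, vecMulVec_apply,
      Matrix.diagonal_mul, Matrix.transpose_apply, hQ, Matrix.of_apply, smul_eq_mul]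
    refine Finset.sum_congr rfl fun l _ => by ring
  have hdet : N.det = (∏ j, lam (a, j)) * Q.det ^ 2 := by
    rw [hN1, det_mul, det_mul, det_transpose, det_diagonal]
    ring
  have hN : N.PosDef := by
    refine Matrix.PosDef.of_dotProduct_mulVec_pos (WS_herm _ _) ?_
    intro v hv
    have h1 : star v = v := by ext; simp
    rw [h1, WS_qf]
    have hQv : Q *ᵥ v ≠ 0 := by
      intro h0
      exact hr a (Matrix.exists_mulVec_eq_zero_iff.mp ⟨v, hv, h0⟩)
    obtain ⟨j, hj⟩ := Function.ne_iff.mp hQv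
    have hj' : r (a, j) ⬝ᵥ v ≠ 0 := hj
    refine Finset.sum_pos' (fun l _ => ?_) ⟨j, Finset.mem_univ _, ?_⟩
    · have := hl (a, l)
      nlinarith [mul_nonneg this.le (mul_self_nonneg (r (a, l) ⬝ᵥ v))]
    · have := hl (a, j)
      nlinarith [mul_pos this (mul_self_pos.mpr hj')]
  have hsplit : WS r lam = N + ∑ p ∈ Finset.univ.filter (fun p : Fin k × n => ¬ p.1 = a),
      lam p • vecMulVec (r p) (r p) := by
    have h1 : N = ∑ p ∈ Finset.univ.filter (fun p : Fin k × n => p.1 = a),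
      lam p • vecMulVec (r p) (r p) := by
      simp only [N, WS]
      rw [Finset.sum_filter, Fintype.sum_prod_type]
      rw [Finset.sum_eq_single a]
      · simp
      · intro b _ hb; simp [hb]
      · simp
    rw [h1, Finset.sum_filter_add_sum_filter_not]
    rfl
  rw [hsplit, ← hdet]
  exact posDef_add_sum hN lam (fun p => (hl p).le) r _

lemma det_rank_one_smul {n : Type*} [Fintype n] [DecidableEq n] {M : Matrix n n ℝ}
    (hM : M.PosDef) (r : n → ℝ) (t : ℝ) :
    (M + t • vecMulVec r r).det = M.det * (1 + t * (r ⬝ᵥ (M⁻¹ *ᵥ r))) := by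
  rw [det_affine M r r t, det_rank_one hM]
  ring

lemma exists_weights {n : Type*} [Fintype n] [DecidableEq n] {k : ℕ} (hk : 1 ≤ k)
    (r : Fin k × n → n → ℝ) (hr : ∀ a, (Matrix.of fun j => r (a, j)).det ≠ 0) :
    ∃ lam : Fin k × n → ℝ, (∀ p, 0 < lam p) ∧ (WS r lam).PosDef ∧
      ∀ p, lam p * (r p ⬝ᵥ ((WS r lam)⁻¹ *ᵥ r p)) ≤ 2 / k := by
  let g : (Fin k × n → ℝ) → ℝ := fun lam => (WS r lam).det ^ k / ∏ p, lam p
  let K : ℝ := ∏ a, (Matrix.of fun j => r (a, j)).det ^ 2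
  have hK : 0 < K := Finset.prod_pos fun a _ => by have := hr a; positivity
  have hg : ∀ lam : Fin k × n → ℝ, (∀ p, 0 < lam p) → K ≤ g lam := by
    intro lam hl
    have hp : 0 < ∏ p, lam p := Finset.prod_pos fun p _ => hl p
    rw [le_div_iff₀ hp, Fintype.prod_prod_type, ← Finset.prod_mul_distrib]
    have : (WS r lam).det ^ k = ∏ a : Fin k, (WS r lam).det := by simp
    rw [this]
    refine Finset.prod_le_prod (fun a _ => ?_) (fun a _ => ?_)
    · have : 0 < ∏ j, lam (a, j) := Finset.prod_pos fun j _ => hl _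
      positivity
    · rw [mul_comm]
      exact (WS_lower r hr a lam hl).2
  let G : Set ℝ := Set.image g {lam | ∀ p, 0 < lam p}
  have hGne : G.Nonempty := ⟨_, (fun _ => 1), fun _ => one_pos, rfl⟩
  have hGK : ∀ z ∈ G, K ≤ z := by rintro z ⟨lam, hl, rfl⟩; exact hg lam hl
  have hGb : BddBelow G := ⟨K, hGK⟩
  have hInf : 0 < sInf G := hK.trans_le (le_csInf hGne hGK)
  obtain ⟨z, ⟨lam, hl, rfl⟩, hz⟩ := exists_lt_of_csInf_lt hGne
    (show sInf G < 1.3 * sInf G by linarith)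
  have hl' : ∀ p, 0 < lam p := hl
  have a0 : Fin k := ⟨0, hk⟩
  have hM := (WS_lower r hr a0 lam hl).1
  refine ⟨lam, hl, hM, fun p => ?_⟩
  by_contra hcon
  push Not at hcon
  set q := lam p * (r p ⬝ᵥ ((WS r lam)⁻¹ *ᵥ r p)) with hq
  let mu : Fin k × n → ℝ := lam + Pi.single p (-(lam p / 2))
  have hmup : mu = Function.update lam p (lam p / 2) := by
    ext l
    by_cases h : l = p
    · subst h; simp [mu]; ring
    · simp [mu, h]
  have hmu : ∀ l, 0 < mu l := by
    intro l
    rw [hmup]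
    by_cases h : l = p
    · subst h; simp [hl' l]
    · simp [h, hl' l]
  have hprod : ∏ l, mu l = (∏ l, lam l) / 2 := by
    rw [hmup, Finset.prod_update_of_mem (Finset.mem_univ p),
      ← Finset.mul_prod_erase Finset.univ lam (Finset.mem_univ p), Finset.sdiff_singleton_eq_erase]
    ring
  have hdet : (WS r mu).det = (WS r lam).det * (1 - q / 2) := by
    simp only [mu]
    rw [WS_add_single, det_rank_one_smul hM, hq]
    ring
  have hpos := (WS_lower r hr a0 mu hmu).1.det_pos
  have hdp := hM.det_pos
  have hq1 : 0 < 1 - q / 2 := by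
    rw [hdet] at hpos
    exact (pos_iff_pos_of_mul_pos hpos).mp hdp
  have hk0 : (0 : ℝ) < k := by exact_mod_cast hk
  have h1 : (1 - q / 2) ^ k ≤ Real.exp (-1) := by
    have := Real.one_sub_div_pow_le_exp_neg (n := k) (t := 1) (by exact_mod_cast hk)
    refine le_trans (pow_le_pow_left₀ hq1.le ?_ k) this
    have : 2 / (k : ℝ) = 2 * (1 / k) := by ring
    rw [this] at hcon
    linarith
  have h2 : Real.exp (-1) ≤ 1 / 2.7 := by
    rw [Real.exp_neg, ← one_div]
    exact one_div_le_one_div_of_le (by norm_num) (by linarith [Real.exp_one_gt_d9])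
  have h3 : g mu = 2 * (1 - q / 2) ^ k * g lam := by
    have hp : 0 < ∏ p, lam p := Finset.prod_pos fun p _ => hl' p
    simp only [g]
    rw [hdet, hprod, mul_pow]
    field_simp
  have h4 : sInf G ≤ g mu := csInf_le hGb ⟨mu, hmu, rfl⟩
  have h5 : 0 < g lam := hK.trans_le (hg lam hl')
  have h6 : 2 * (1 - q / 2) ^ k * g lam ≤ 2 * (1 / 2.7) * g lam := by
    refine mul_le_mul_of_nonneg_right ?_ h5.le
    linarith
  rw [h3] at h4
  norm_num at h6 hz h4 ⊢
  linarith

open scoped MatrixOrder in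
lemma barthe {n : Type*} [Fintype n] [DecidableEq n] {k : ℕ} (hk : 1 ≤ k)
    (r : Fin k × n → n → ℝ) (hr : ∀ a, (Matrix.of fun j => r (a, j)).det ≠ 0) :
    ∃ w : Fin k × n → n → ℝ, (∀ p, w p ⬝ᵥ w p ≤ 2 / k) ∧
      (∀ x, ∑ p, (w p ⬝ᵥ x) ^ 2 = x ⬝ᵥ x) ∧
      ∀ y, y ≠ 0 → ∃ x, x ≠ 0 ∧ ∀ p, r p ⬝ᵥ y = 0 → w p ⬝ᵥ x = 0 := by
  obtain ⟨lam, hl, hM, hp⟩ := exists_weights hk r hr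
  set M := WS r lam with hMdef
  obtain ⟨Q, hQ⟩ := CStarAlgebra.nonneg_iff_eq_star_mul_self.mp hM.posSemidef.nonneg
  have hQ' : M = Qᵀ * Q := by
    rw [hQ, Matrix.star_eq_conjTranspose, Matrix.conjTranspose_eq_transpose_of_trivial]
  have hQd : Q.det ≠ 0 := by
    intro h0
    have := hM.det_pos
    rw [hQ', det_mul, h0, mul_zero] at this
    exact lt_irrefl _ this
  have hu : IsUnit Q.det := isUnit_iff_ne_zero.mpr hQd
  have huT : IsUnit Qᵀ.det := by rwa [det_transpose]
  let B : Matrix n n ℝ := (Qᵀ)⁻¹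
  have hBT : Bᵀ = Q⁻¹ := by
    simp only [B]
    rw [Matrix.transpose_nonsing_inv, Matrix.transpose_transpose]
  have hBB : Bᵀ * B = M⁻¹ := by
    rw [hBT, hQ', Matrix.mul_inv_rev]
  have hdB : ∀ a b : n → ℝ, (B *ᵥ a) ⬝ᵥ b = a ⬝ᵥ (Bᵀ *ᵥ b) := by
    intro a b
    rw [Matrix.mulVec_transpose, dotProduct_comm, Matrix.dotProduct_mulVec, dotProduct_comm]
  refine ⟨fun p => √(lam p) • (B *ᵥ r p), fun p => ?_, fun x => ?_, fun y hy => ?_⟩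
  · have := hp p
    rw [smul_dotProduct, dotProduct_smul, hdB, Matrix.mulVec_mulVec, hBB, smul_smul,
      Real.mul_self_sqrt (hl p).le]
    exact this
  · have h1 : ∀ p, ((√(lam p) • (B *ᵥ r p)) ⬝ᵥ x) ^ 2 =
        lam p * (r p ⬝ᵥ (Bᵀ *ᵥ x)) * (r p ⬝ᵥ (Bᵀ *ᵥ x)) := by
      intro p
      rw [smul_dotProduct, hdB, smul_eq_mul, mul_pow, Real.sq_sqrt (hl p).le]
      ring
    simp only [h1]
    rw [← WS_qf, ← hMdef, dotProduct_comm, ← hdB, Matrix.mulVec_mulVec,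
      Matrix.mulVec_mulVec]
    have : B * (M * Bᵀ) = 1 := by
      rw [hBT, hQ', Matrix.mul_assoc, Matrix.mul_nonsing_inv _ hu, Matrix.mul_one]
      exact Matrix.nonsing_inv_mul _ huT
    rw [Matrix.mul_assoc, this, Matrix.one_mulVec]
  · refine ⟨Q *ᵥ y, ?_, ?_⟩
    · intro h0
      exact hQd (Matrix.exists_mulVec_eq_zero_iff.mp ⟨y, hy, h0⟩)
    · intro p hp0
      rw [smul_dotProduct, hdB, Matrix.mulVec_mulVec, hBT, Matrix.nonsing_inv_mul _ hu,
        Matrix.one_mulVec, hp0, smul_zero]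

end ThinBasis

namespace ThinBasis
open Matrix

lemma psd_iff {m d : ℕ} (v : Fin m → Fin d → ℝ) (T : Finset (Fin m)) (c : ℝ) :
    Matrix.PosSemidef (c • (1 : Matrix (Fin d) (Fin d) ℝ) - ∑ i ∈ T, vecMulVec (v i) (v i)) ↔
      ∀ y : Fin d → ℝ, ∑ i ∈ T, (v i ⬝ᵥ y) ^ 2 ≤ c * (y ⬝ᵥ y) := by
  have key : ∀ y : Fin d → ℝ,
      y ⬝ᵥ ((c • (1 : Matrix (Fin d) (Fin d) ℝ) - ∑ i ∈ T, vecMulVec (v i) (v i)) *ᵥ y) =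
        c * (y ⬝ᵥ y) - ∑ i ∈ T, (v i ⬝ᵥ y) ^ 2 := by
    intro y
    rw [Matrix.sub_mulVec, Matrix.smul_mulVec, Matrix.one_mulVec, dotProduct_sub, dotProduct_smul,
      smul_eq_mul, Matrix.sum_mulVec, dotProduct_sum]
    congr 1
    refine Finset.sum_congr rfl fun i _ => ?_
    rw [Matrix.vecMulVec_mulVec, dotProduct_comm y]
    simp only [dotProduct, Pi.smul_apply, sq]
    rw [Finset.mul_sum]
    refine Finset.sum_congr rfl fun j _ => ?_
    simp
    ring
  have hs : ∀ y : Fin d → ℝ, star y = y := by intro y; ext; simp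
  constructor
  · intro h y
    have := h.dotProduct_mulVec_nonneg y
    rw [hs, key] at this
    linarith
  · intro h
    refine Matrix.PosSemidef.of_dotProduct_mulVec_nonneg ?_ ?_
    · ext i j
      simp [Matrix.sum_apply, vecMulVec_apply, Matrix.one_apply, mul_comm, eq_comm]
    · intro y
      rw [hs, key]
      linarith [h y]

lemma exists_basis_of_span {m d : ℕ} (v : Fin m → Fin d → ℝ) {ι : Type} [Fintype ι] (f : ι → Fin m)
    (hf : Function.Injective f) (S : Finset ι)
    (hS : ∀ y : Fin d → ℝ, y ≠ 0 → ∃ p ∈ S, v (f p) ⬝ᵥ y ≠ 0) :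
    ∃ T : Finset (Fin m), IsBasisSet v T ∧
      ∀ y, ∑ i ∈ T, (v i ⬝ᵥ y) ^ 2 ≤ ∑ p ∈ S, (v (f p) ⬝ᵥ y) ^ 2 := by
  classical
  obtain ⟨κ, a, ha, hsp, hli⟩ := exists_linearIndependent' ℝ (fun p : S => v (f p))
  have htop : Submodule.span ℝ (Set.range (fun p : S => v (f p))) = ⊤ := by
    by_contra hne
    obtain ⟨F, hF0, hF⟩ := Submodule.exists_le_ker_of_lt_top _ (lt_top_iff_ne_top.mpr hne)
    let y : Fin d → ℝ := fun i => F (fun j => if i = j then 1 else 0)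
    have hFy : ∀ x, F x = x ⬝ᵥ y := by
      intro x
      rw [LinearMap.pi_apply_eq_sum_univ]
      simp [dotProduct, y]
    have hy : y ≠ 0 := by
      intro h0
      apply hF0
      refine LinearMap.ext fun x => ?_
      rw [hFy, h0]
      simp
    obtain ⟨p, hp, hpy⟩ := hS y hy
    apply hpy
    rw [← hFy]
    exact hF (Submodule.subset_span ⟨⟨p, hp⟩, rfl⟩)
  have : Finite κ := Finite.of_injective a ha
  have : Fintype κ := Fintype.ofFinite κ
  let g : κ → Fin m := fun l => f (a l)
  have hg : Function.Injective g := fun x y h => ha (Subtype.ext (hf h))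
  let e : κ ≃ (Finset.univ.image g : Finset (Fin m)) :=
    Equiv.ofBijective (fun l => ⟨g l, Finset.mem_image_of_mem g (Finset.mem_univ l)⟩) (by
      constructor
      · intro x y h
        exact hg (congrArg Subtype.val h)
      · rintro ⟨x, hx⟩
        obtain ⟨l, -, rfl⟩ := Finset.mem_image.mp hx
        exact ⟨l, rfl⟩)
  refine ⟨Finset.univ.image g, ⟨?_, ?_⟩, fun y => ?_⟩
  · rw [Finset.card_image_of_injective _ hg, Finset.card_univ]
    have := Module.finrank_eq_card_basis (Module.Basis.mk hli (by rw [hsp, htop]))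
    rw [← this]
    simp
  · exact (linearIndependent_equiv' e (by rfl)).mp hli
  · rw [Finset.sum_image (fun x _ y _ h => hg h)]
    rw [← Finset.sum_coe_sort S]
    have := Finset.sum_image (s := Finset.univ) (g := a) (f := fun p : S => (v (f p) ⬝ᵥ y) ^ 2)
      (fun x _ y _ h => ha h)
    refine le_trans (le_of_eq this.symm) ?_
    exact Finset.sum_le_sum_of_subset_of_nonneg (Finset.subset_univ _) fun _ _ _ => sq_nonneg _

theorem main_bound {m d k : ℕ} (v : Fin m → Fin d → ℝ) (ε : ℝ) (hd : 0 < d) (hk : 1 ≤ k)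
    (hM : ∀ y : Fin d → ℝ, ∑ i, (v i ⬝ᵥ y) ^ 2 ≤ y ⬝ᵥ y)
    (hε : ∀ i, v i ⬝ᵥ v i ≤ ε) (T : Fin k → Finset (Fin m))
    (hT : ∀ a b : Fin k, a ≠ b → Disjoint (T a) (T b)) (hB : ∀ a, IsBasisSet v (T a)) :
    ∃ S : Finset (Fin m), IsBasisSet v S ∧
      ∀ y : Fin d → ℝ, ∑ i ∈ S, (v i ⬝ᵥ y) ^ 2 ≤ 20000 * (ε + 1 / (k : ℝ)) * (y ⬝ᵥ y) := by
  let f : Fin k × Fin d → Fin m := fun p => (T p.1).orderEmbOfFin (hB p.1).1 p.2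
  have hfT : ∀ p, f p ∈ T p.1 := fun p => Finset.orderEmbOfFin_mem _ _ _
  have hf : Function.Injective f := by
    rintro ⟨a, i⟩ ⟨b, j⟩ h
    by_cases hab : a = b
    · subst hab
      have := ((T a).orderEmbOfFin (hB a).1).injective h
      exact Prod.ext rfl this
    · exact absurd h (fun h => Finset.disjoint_left.mp (hT a b hab) (hfT (a, i)) (h ▸ hfT (b, j)))
  let r : Fin k × Fin d → Fin d → ℝ := fun p => v (f p)
  have hr : ∀ a, (Matrix.of fun j => r (a, j)).det ≠ 0 := by
    intro a
    rw [← isUnit_iff_ne_zero, ← Matrix.isUnit_iff_isUnit_det,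
      ← Matrix.linearIndependent_rows_iff_isUnit]
    exact (hB a).2.comp (fun j : Fin d => (⟨f (a, j), hfT (a, j)⟩ : T a)) (by
      intro i j h
      have h' : f (a, i) = f (a, j) := congrArg Subtype.val h
      have := hf h'
      exact (Prod.mk.inj this).2)
  have hk0 : (0 : ℝ) < k := by exact_mod_cast hk
  have hε0 : 0 ≤ ε := (dot_self_nonneg _).trans (hε (f (⟨0, hk⟩, ⟨0, hd⟩)))
  obtain ⟨η, hη⟩ : ∃ η, η = ε + 2 / (k : ℝ) := ⟨_, rfl⟩
  have hη0 : 0 < η := by rw [hη]; positivity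
  have hη2 : η ≤ 2 * (ε + 1 / (k : ℝ)) := by
    have : 2 / (k : ℝ) = 2 * (1 / k) := by ring
    rw [hη, this]; linarith
  by_cases hbig : 1600 * η ≤ 1
  swap
  · refine ⟨T ⟨0, hk⟩, hB _, fun y => ?_⟩
    have h1 : ∑ i ∈ T ⟨0, hk⟩, (v i ⬝ᵥ y) ^ 2 ≤ ∑ i, (v i ⬝ᵥ y) ^ 2 :=
      Finset.sum_le_sum_of_subset_of_nonneg (Finset.subset_univ _) fun _ _ _ => sq_nonneg _
    have h2 := hM y
    have h3 := dot_self_nonneg y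
    have h4 : 1 ≤ 20000 * (ε + 1 / (k : ℝ)) := by linarith
    nlinarith
  obtain ⟨w, hw1, hw2, hw3⟩ := barthe hk r hr
  have hr2 : ∀ y : Fin d → ℝ, ∑ p, (r p ⬝ᵥ y) ^ 2 ≤ y ⬝ᵥ y := by
    intro y
    refine le_trans ?_ (hM y)
    have := Finset.sum_image (s := Finset.univ) (g := f) (f := fun i => (v i ⬝ᵥ y) ^ 2)
      (fun x _ y _ h => hf h)
    refine le_trans (le_of_eq this.symm) ?_
    exact Finset.sum_le_sum_of_subset_of_nonneg (Finset.subset_univ _) fun _ _ _ => sq_nonneg _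
  let u : Fin k × Fin d → (Fin d ⊕ Fin d) → ℝ := fun p => Sum.elim (w p) (r p)
  have hux : ∀ p x y, u p ⬝ᵥ Sum.elim x y = w p ⬝ᵥ x + r p ⬝ᵥ y := by
    intro p x y
    simp [u, dotProduct, Fintype.sum_sum_type]
  have hxx : ∀ x y : Fin d → ℝ, Sum.elim x y ⬝ᵥ Sum.elim x y = x ⬝ᵥ x + y ⬝ᵥ y := by
    intro x y
    simp [dotProduct, Fintype.sum_sum_type]
  have hu1 : ∀ p, u p ⬝ᵥ u p ≤ η := by
    intro p
    have := hw1 p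
    have h2 := hε (f p)
    rw [hη]
    simp only [u, hxx]
    have h3 : r p ⬝ᵥ r p ≤ ε := h2
    linarith
  have hu2 : ∀ x : (Fin d ⊕ Fin d) → ℝ, ∑ p, (u p ⬝ᵥ x) ^ 2 ≤ 2 * (x ⬝ᵥ x) := by
    intro x
    obtain ⟨a, b, rfl⟩ : ∃ a b, x = Sum.elim a b :=
      ⟨x ∘ Sum.inl, x ∘ Sum.inr, (Sum.elim_comp_inl_inr x).symm⟩
    have h1 := hw2 a
    have h2 := hr2 b
    have h3 : ∑ p, (u p ⬝ᵥ Sum.elim a b) ^ 2 ≤ ∑ p, (2 * (w p ⬝ᵥ a) ^ 2 + 2 * (r p ⬝ᵥ b) ^ 2) := by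
      refine Finset.sum_le_sum fun p _ => ?_
      rw [hux]
      nlinarith [sq_nonneg (w p ⬝ᵥ a - r p ⬝ᵥ b)]
    rw [Finset.sum_add_distrib, ← Finset.mul_sum, ← Finset.mul_sum] at h3
    rw [hxx]
    linarith
  obtain ⟨j, hj1, hj2⟩ := exists_nat_pow_near_of_lt_one (x := 1600 * η) (y := (1 / 2 : ℝ))
    (by positivity) hbig (by norm_num) (by norm_num)
  obtain ⟨t, ht⟩ : ∃ t : ℝ, t = (1 / 2) ^ j := ⟨_, rfl⟩
  have ht0 : 0 < t := by rw [ht]; positivity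
  rw [pow_succ, ← ht] at hj1
  rw [← ht] at hj2
  obtain ⟨S, hS⟩ := iterate_halve u hη0 hu1 hu2 j t ht hj2
  have he : 20 * √(η * t) ≤ t / 2 := by
    have : √(η * t) ≤ t / 40 := by
      rw [Real.sqrt_le_left (by positivity)]
      nlinarith
    linarith
  obtain ⟨B, hB1, hB2⟩ := exists_basis_of_span v f hf S (by
    intro y hy
    obtain ⟨x, hx, hxy⟩ := hw3 y hy
    by_contra hcon
    push Not at hcon
    have h1 := (abs_le.mp (hS (Sum.elim x 0))).1
    simp only [hux, hxx, dotProduct_zero, add_zero, hw2] at h1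
    have h2 : ∑ p ∈ S, (w p ⬝ᵥ x) ^ 2 = 0 := by
      refine Finset.sum_eq_zero fun p hp => ?_
      rw [hxy p (hcon p hp)]
      norm_num
    have h3 : 0 < x ⬝ᵥ x := by
      refine lt_of_le_of_ne (dot_self_nonneg x) fun h0 => hx ?_
      exact dotProduct_self_eq_zero.mp h0.symm
    rw [h2] at h1
    nlinarith [mul_le_mul_of_nonneg_right he h3.le, mul_pos ht0 h3])
  refine ⟨B, hB1, fun y => (hB2 y).trans ?_⟩
  have h1 := (abs_le.mp (hS (Sum.elim 0 y))).2
  simp only [hux, hxx, dotProduct_zero, zero_add] at h1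
  have h2 := hr2 y
  have h3 := dot_self_nonneg y
  have h4 : ∑ p ∈ S, (v (f p) ⬝ᵥ y) ^ 2 ≤ 3 * t * (y ⬝ᵥ y) := by
    have : ∑ p ∈ S, (v (f p) ⬝ᵥ y) ^ 2 = ∑ p ∈ S, (r p ⬝ᵥ y) ^ 2 := rfl
    rw [this]
    nlinarith [mul_le_mul_of_nonneg_right he h3, mul_le_mul_of_nonneg_left h2 ht0.le]
  refine h4.trans (mul_le_mul_of_nonneg_right ?_ h3)
  linarith

end ThinBasis

/-- There is a universal constant `C > 0` such that: if `Σ v_i v_iᵀ ⪯ I`, `‖v_i‖² ≤ ε` for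
all `i`, and the vectors contain `k ≥ 1` pairwise disjoint bases, then there is a basis `T`
with `Σ_{i∈T} v_i v_iᵀ ⪯ C·(ε + 1/k)·I`. -/
theorem stmt2 :
    ∃ C : ℝ, 0 < C ∧
      ∀ (m d k : ℕ) (v : Fin m → Fin d → ℝ) (ε : ℝ),
        1 ≤ k →
        Matrix.PosSemidef
          ((1 : Matrix (Fin d) (Fin d) ℝ) - ∑ i : Fin m, Matrix.vecMulVec (v i) (v i)) →
        (∀ i, ∑ j, v i j ^ 2 ≤ ε) →
        (∃ T : Fin k → Finset (Fin m),
          (∀ a b : Fin k, a ≠ b → Disjoint (T a) (T b)) ∧ ∀ a, IsBasisSet v (T a)) →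
        ∃ T : Finset (Fin m), IsBasisSet v T ∧
          Matrix.PosSemidef
            ((C * (ε + 1 / (k : ℝ))) • (1 : Matrix (Fin d) (Fin d) ℝ)
              - ∑ i ∈ T, Matrix.vecMulVec (v i) (v i)) := by
  refine ⟨20000, by norm_num, ?_⟩
  intro m d k v ε hk hM hε ⟨T, hT, hB⟩
  rcases Nat.eq_zero_or_pos d with hd | hd
  · subst hd
    refine ⟨T ⟨0, hk⟩, hB _, ?_⟩
    rw [ThinBasis.psd_iff]
    intro y
    simp [dotProduct]
  · have h1 := (ThinBasis.psd_iff v Finset.univ 1).mp (by rw [one_smul]; exact hM)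
    obtain ⟨S, hS1, hS2⟩ := ThinBasis.main_bound v ε hd hk (fun y => by simpa using h1 y)
      (fun i => by
        have := hε i
        simpa only [dotProduct, sq] using this) T hT hB
    exact ⟨S, hS1, (ThinBasis.psd_iff v S _).mpr hS2⟩
end
end

section
/- Let v_1,...,v_m ∈ ℝ^d and let μ be a homogeneous probability distribution on subsets of [m] whose generating polynomial g_μ is homogeneous of degree d_μ. Then the following identity of polynomials in x holds: x^{d_μ} · Σ_{S⊆[m]} μ(S) · det(x²·I − Σ_{i∈S} 2·v_i v_iᵀ) = x^{d} · [ Π_{i=1}^m (1 − ∂²_{z_i}) ( g_μ(x·1 + z) · det(x·I + Σ_{i=1}^m z_i v_i v_iᵀ) ) ] evaluated at z_1 = ... = z_m = 0, where g_μ(x·1 + z) denotes g_μ with z_i + x substituted for z_i. -/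
noncomputable section

theorem aux_pd {m : ℕ} {R : Type*} [CommRing R] (i j : Fin m) (g : Polynomial R) :
    MvPolynomial.pderiv i (Polynomial.aeval (MvPolynomial.X j : MvPolynomial (Fin m) R) g)
      = if i = j then Polynomial.aeval (MvPolynomial.X j) (Polynomial.derivative g) else 0 := by
  induction g using Polynomial.induction_on' with
  | add p q hp hq =>
    simp only [map_add, hp, hq]
    split_ifs <;> simp
  | monomial n a =>
    rw [← Polynomial.C_mul_X_pow_eq_monomial]
    simp only [map_mul, map_pow, Polynomial.aeval_X, Polynomial.aeval_C,
      MvPolynomial.algebraMap_eq, MvPolynomial.pderiv_C_mul, Derivation.leibniz_pow,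
      MvPolynomial.pderiv_X, Polynomial.derivative_C_mul_X_pow]
    by_cases h : i = j
    · subst h
      simp [MvPolynomial.algebraMap_eq, MvPolynomial.C_mul', smul_smul]
      try ring_nf
    · simp [h, Pi.single_apply, Ne.symm h, eq_comm]

def auxOp {m : ℕ} {R : Type*} [CommRing R] (i : Fin m) (q : MvPolynomial (Fin m) R) :
    MvPolynomial (Fin m) R := q - MvPolynomial.pderiv i (MvPolynomial.pderiv i q)

theorem aux_op {m : ℕ} {R : Type*} [CommRing R] (i : Fin m) (f : Fin m → Polynomial R) :
    auxOp i (∏ j, Polynomial.aeval (MvPolynomial.X j : MvPolynomial (Fin m) R) (f j)) =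
    ∏ j, Polynomial.aeval (MvPolynomial.X j : MvPolynomial (Fin m) R)
      (if j = i then f j - Polynomial.derivative (Polynomial.derivative (f j)) else f j) := by
  have key : ∀ g : Polynomial R, MvPolynomial.pderiv i
      (Polynomial.aeval (MvPolynomial.X i : MvPolynomial (Fin m) R) g *
        ∏ j ∈ Finset.univ.erase i, Polynomial.aeval (MvPolynomial.X j) (f j)) =
      Polynomial.aeval (MvPolynomial.X i : MvPolynomial (Fin m) R) (Polynomial.derivative g) *
        ∏ j ∈ Finset.univ.erase i, Polynomial.aeval (MvPolynomial.X j) (f j) := by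
    intro g
    have h0 : MvPolynomial.pderiv i (∏ j ∈ Finset.univ.erase i,
        Polynomial.aeval (MvPolynomial.X j : MvPolynomial (Fin m) R) (f j)) = 0 := by
      apply Finset.prod_induction _ (fun p => MvPolynomial.pderiv i p = 0)
      · intro a b ha hb
        simp [Derivation.leibniz, ha, hb]
      · simp
      · intro j hj
        rw [aux_pd, if_neg (Finset.ne_of_mem_erase hj).symm]
    rw [Derivation.leibniz, h0, aux_pd, if_pos rfl]
    simp [mul_comm]
  rw [auxOp, ← Finset.mul_prod_erase _ _ (Finset.mem_univ i), key, key,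
    ← Finset.mul_prod_erase _ _ (Finset.mem_univ i), if_pos rfl, ← sub_mul, ← map_sub]
  congr 1
  apply Finset.prod_congr rfl
  intro j hj
  rw [if_neg (Finset.ne_of_mem_erase hj)]

theorem aux_fold {m : ℕ} {R : Type*} [CommRing R] (l : List (Fin m)) (hl : l.Nodup)
    (f : Fin m → Polynomial R) :
    l.foldr auxOp (∏ j, Polynomial.aeval (MvPolynomial.X j : MvPolynomial (Fin m) R) (f j)) =
    ∏ j, Polynomial.aeval (MvPolynomial.X j : MvPolynomial (Fin m) R)
      (if j ∈ l then f j - Polynomial.derivative (Polynomial.derivative (f j)) else f j) := by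
  induction l with
  | nil => simp
  | cons a l ih =>
    rw [List.nodup_cons] at hl
    rw [List.foldr_cons, ih hl.2, aux_op]
    apply Finset.prod_congr rfl
    intro j _
    by_cases h : j = a
    · subst h; simp [hl.1]
    · simp [h]

theorem aux_lin {m : ℕ} {R : Type*} [CommRing R] (l : List (Fin m)) :
    ∃ F : MvPolynomial (Fin m) R →ₗ[R] MvPolynomial (Fin m) R, ∀ q, l.foldr auxOp q = F q := by
  induction l with
  | nil => exact ⟨LinearMap.id, fun q => rfl⟩
  | cons a l ih =>
    obtain ⟨F, hF⟩ := ih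
    refine ⟨F - (MvPolynomial.pderiv a).toLinearMap ∘ₗ (MvPolynomial.pderiv a).toLinearMap ∘ₗ F, ?_⟩
    intro q
    rw [List.foldr_cons, hF]
    simp [auxOp]

theorem aux_main {m : ℕ} {R K : Type*} [CommRing R] [Field K] [Algebra R K]
    (x : R) (hx : algebraMap R K x ≠ 0) (S : Finset (Fin m)) (D : MvPolynomial (Fin m) R)
    (hD : ∀ i, MvPolynomial.degreeOf i D ≤ 1) :
    algebraMap R K (MvPolynomial.eval (fun _ => 0) ((List.finRange m).foldr auxOp
      ((∏ i ∈ S, (MvPolynomial.X i + MvPolynomial.C x)) * D))) =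
    (algebraMap R K x) ^ S.card *
      MvPolynomial.aeval (fun i => if i ∈ S then -2 / algebraMap R K x else 0) D := by
  obtain ⟨F, hF⟩ := aux_lin (R := R) (List.finRange m)
  have mono : ∀ s : Fin m →₀ ℕ, (∀ i, s i ≤ 1) →
      algebraMap R K (MvPolynomial.eval (fun _ => 0) ((List.finRange m).foldr auxOp
      ((∏ i ∈ S, (MvPolynomial.X i + MvPolynomial.C x)) * ∏ i, MvPolynomial.X i ^ s i))) =
      (algebraMap R K x) ^ S.card *
       ∏ i, (if i ∈ S then -2 / algebraMap R K x else 0) ^ s i := by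
    intro s hs
    have e1 : (∏ i ∈ S, (MvPolynomial.X i + MvPolynomial.C x)) * ∏ i, MvPolynomial.X i ^ s i
      = ∏ j, Polynomial.aeval (MvPolynomial.X j : MvPolynomial (Fin m) R)
        ((if j ∈ S then Polynomial.X + Polynomial.C x else 1) * Polynomial.X ^ s j) := by
      simp only [map_mul, Finset.prod_mul_distrib, map_pow, Polynomial.aeval_X]
      congr 1
      rw [← Finset.prod_subset (Finset.subset_univ S)]
      · apply Finset.prod_congr rfl
        intro i hi
        simp [hi, MvPolynomial.algebraMap_eq]
      · intro i _ hi
        simp [hi]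
    have e2 : (algebraMap R K x) ^ S.card = ∏ i, if i ∈ S then algebraMap R K x else 1 := by
      simp
    have e3 : ∀ (j : Fin m) (g : Polynomial R), MvPolynomial.eval (fun _ => 0)
        (Polynomial.aeval (MvPolynomial.X j : MvPolynomial (Fin m) R) g) = g.eval 0 := by
      intro j g
      have := Polynomial.hom_eval₂ g (algebraMap R (MvPolynomial (Fin m) R))
        (MvPolynomial.eval (fun _ : Fin m => (0:R))) (MvPolynomial.X j)
      rw [Polynomial.aeval_def, this, MvPolynomial.eval_X, Polynomial.eval]
      congr 1
      ext r
      simp [MvPolynomial.algebraMap_eq]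
    rw [e1, aux_fold _ (List.nodup_finRange m), e2, ← Finset.prod_mul_distrib, map_prod, map_prod]
    apply Finset.prod_congr rfl
    intro i _
    rw [e3, if_pos (List.mem_finRange i)]
    have h1 := hs i
    interval_cases s i
    · by_cases hi : i ∈ S <;> simp [hi]
    · by_cases hi : i ∈ S
      · simp [hi]
        field_simp
        try norm_num
      · simp [hi]
  conv_lhs => rw [D.as_sum]
  conv_rhs => rw [D.as_sum]
  rw [Finset.mul_sum, hF, map_sum, map_sum, map_sum, map_sum, Finset.mul_sum]
  apply Finset.sum_congr rfl
  intro s hs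
  have hs1 : ∀ i, s i ≤ 1 := fun i => (MvPolynomial.monomial_le_degreeOf i hs).trans (hD i)
  have e : MvPolynomial.monomial s (D.coeff s) = D.coeff s • ∏ i, MvPolynomial.X i ^ s i := by
    rw [MvPolynomial.monomial_eq, MvPolynomial.C_mul', Finsupp.prod_fintype _ _ (by simp)]
  rw [e, mul_smul_comm, map_smul, ← hF, MvPolynomial.smul_eval, map_mul, mono s hs1,
    map_smul, map_prod, Algebra.smul_def]
  simp only [map_pow, MvPolynomial.aeval_X]
  ring

theorem aux_deg {m d : ℕ} {R : Type*} [CommRing R] [Nontrivial R] (x : R) (V : Fin m → Fin d → R)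
    (k : Fin m) :
    MvPolynomial.degreeOf k
      ((MvPolynomial.C x : MvPolynomial (Fin m) R) •
                  (1 : Matrix (Fin d) (Fin d) (MvPolynomial (Fin m) R)) +
                ∑ i : Fin m, (MvPolynomial.X i : MvPolynomial (Fin m) R) •
                  (Matrix.vecMulVec (V i) (V i)).map
                    (fun a => MvPolynomial.C a)).det ≤ 1 := by
  set M : Matrix (Fin d ⊕ Fin m) (Fin d ⊕ Fin m) (MvPolynomial (Fin m) R) :=
    Matrix.fromBlocks ((MvPolynomial.C x : MvPolynomial (Fin m) R) • 1)
      (Matrix.of fun a i => -(MvPolynomial.X i * MvPolynomial.C (V i a)))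
      (Matrix.of fun i a => MvPolynomial.C (V i a)) 1 with hM
  have hdet : M.det = ((MvPolynomial.C x : MvPolynomial (Fin m) R) •
                  (1 : Matrix (Fin d) (Fin d) (MvPolynomial (Fin m) R)) +
                ∑ i : Fin m, (MvPolynomial.X i : MvPolynomial (Fin m) R) •
                  (Matrix.vecMulVec (V i) (V i)).map
                    (fun a => MvPolynomial.C a)).det := by
    rw [hM, Matrix.det_fromBlocks_one₂₂]
    congr 1
    ext1 a b
    simp [Matrix.mul_apply, Matrix.sum_apply, Matrix.vecMulVec_apply, mul_assoc]
  rw [← hdet, Matrix.det_apply]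
  refine (MvPolynomial.degreeOf_sum_le _ _ _).trans (Finset.sup_le fun σ _ => ?_)
  have hs : MvPolynomial.degreeOf k (Equiv.Perm.sign σ • ∏ i, M (σ i) i)
      ≤ MvPolynomial.degreeOf k (∏ i, M (σ i) i) := by
    rcases Int.units_eq_one_or (Equiv.Perm.sign σ) with h | h <;> rw [h] <;> simp
  refine hs.trans ((MvPolynomial.degreeOf_prod_le _ _ _).trans ?_)
  have hb : ∀ a b, MvPolynomial.degreeOf k (M a b) ≤ if b = Sum.inr k then 1 else 0 := by
    rintro (a | a) (b | b)
    · simp only [hM, Matrix.fromBlocks_apply₁₁, Matrix.smul_apply, Matrix.one_apply]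
      split_ifs <;> simp
    · simp only [hM, Matrix.fromBlocks_apply₁₂, Matrix.of_apply, MvPolynomial.degreeOf_neg]
      refine (MvPolynomial.degreeOf_mul_le _ _ _).trans ?_
      rw [MvPolynomial.degreeOf_C, MvPolynomial.degreeOf_X]
      by_cases h : k = b
      · simp [h]
      · simp [h]
    · simp [hM]
    · simp only [hM, Matrix.fromBlocks_apply₂₂, Matrix.one_apply]
      split_ifs <;> simp
  refine (Finset.sum_le_sum fun i _ => hb (σ i) i).trans ?_
  simp

/-- For a homogeneous probability distribution `μ` on subsets of `[m]` of degree `dμ`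
and vectors `v_1,...,v_m ∈ ℝ^d`:
`x^{dμ} · Σ_S μ(S)·det(x²·I − Σ_{i∈S} 2 v_i v_iᵀ)`
equals
`x^d · [Π_i (1 − ∂²_{z_i}) (g_μ(x·1 + z)·det(x·I + Σ_i z_i v_i v_iᵀ))]|_{z=0}`,
where the right-hand side is computed in `ℝ[x][z_1,...,z_m]` and then evaluated at
`z_1 = ... = z_m = 0`. -/
theorem stmt11 {m d dμ : ℕ} (μ : Finset (Fin m) → ℝ) (v : Fin m → Fin d → ℝ)
    (hnn : ∀ S, 0 ≤ μ S)
    (hsum : ∑ S : Finset (Fin m), μ S = 1)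
    (hhom : ∀ S, 0 < μ S → S.card = dμ) :
    Polynomial.X ^ dμ *
        ∑ S : Finset (Fin m), Polynomial.C (μ S) *
          ((Polynomial.X ^ 2 : Polynomial ℝ) • (1 : Matrix (Fin d) (Fin d) (Polynomial ℝ)) -
            (∑ i ∈ S, (2 : ℝ) • Matrix.vecMulVec (v i) (v i)).map
              (fun a => Polynomial.C a)).det
      =
      Polynomial.X ^ d *
        MvPolynomial.eval (fun _ : Fin m => (0 : Polynomial ℝ))
          ((List.finRange m).foldr
            (fun i q => q - MvPolynomial.pderiv i (MvPolynomial.pderiv i q))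
            ((∑ S : Finset (Fin m),
                MvPolynomial.C (Polynomial.C (μ S)) *
                  ∏ i ∈ S, (MvPolynomial.X i + MvPolynomial.C Polynomial.X)) *
              ((MvPolynomial.C Polynomial.X : MvPolynomial (Fin m) (Polynomial ℝ)) •
                  (1 : Matrix (Fin d) (Fin d) (MvPolynomial (Fin m) (Polynomial ℝ))) +
                ∑ i : Fin m, (MvPolynomial.X i : MvPolynomial (Fin m) (Polynomial ℝ)) •
                  (Matrix.vecMulVec (v i) (v i)).map
                    (fun a => MvPolynomial.C (Polynomial.C a))).det)) := by
  let R := Polynomial ℝ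
  let K := FractionRing (Polynomial ℝ)
  have hx : algebraMap R K Polynomial.X ≠ 0 := by
    intro h
    exact (Polynomial.X_ne_zero : (Polynomial.X : Polynomial ℝ) ≠ 0)
      ((map_eq_zero_iff _ (IsFractionRing.injective (Polynomial ℝ) K)).1 h)
  set D : MvPolynomial (Fin m) R :=
    ((MvPolynomial.C Polynomial.X : MvPolynomial (Fin m) (Polynomial ℝ)) •
                  (1 : Matrix (Fin d) (Fin d) (MvPolynomial (Fin m) (Polynomial ℝ))) +
                ∑ i : Fin m, (MvPolynomial.X i : MvPolynomial (Fin m) (Polynomial ℝ)) •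
                  (Matrix.vecMulVec (v i) (v i)).map
                    (fun a => MvPolynomial.C (Polynomial.C a))).det with hDdef
  have hD : ∀ i, MvPolynomial.degreeOf i D ≤ 1 := by
    intro i
    have := aux_deg (Polynomial.X : Polynomial ℝ) (fun i a => Polynomial.C (v i a)) i
    have e : ∀ j, (Matrix.vecMulVec (v j) (v j)).map
        (fun a => (MvPolynomial.C (Polynomial.C a) : MvPolynomial (Fin m) (Polynomial ℝ))) =
        (Matrix.vecMulVec (fun a => Polynomial.C (v j a)) (fun a => Polynomial.C (v j a))).map
          (fun a => MvPolynomial.C a) := by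
      intro j
      ext1 a b
      simp [Matrix.vecMulVec_apply]
    rw [hDdef]
    simp only [e]
    exact this
  change _ = Polynomial.X ^ d * MvPolynomial.eval (fun _ : Fin m => (0 : Polynomial ℝ))
    ((List.finRange m).foldr auxOp _)
  obtain ⟨F, hF⟩ := aux_lin (R := R) (List.finRange m)
  rw [hF, Finset.sum_mul, map_sum, map_sum, Finset.mul_sum, Finset.mul_sum]
  refine Finset.sum_congr rfl fun S _ => ?_
  rcases (hnn S).eq_or_lt with h0 | hpos
  · rw [← h0]; simp
  rw [mul_assoc, MvPolynomial.C_mul', map_smul, MvPolynomial.smul_eval, ← hF, ← hhom S hpos,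
    mul_left_comm, mul_left_comm (Polynomial.X ^ d)]
  congr 1
  apply IsFractionRing.injective R K
  rw [map_mul, map_mul, aux_main (K := K) Polynomial.X hx S D hD, map_pow, map_pow,
    mul_left_comm]
  congr 1
  rw [hDdef, AlgHom.map_det, RingHom.map_det]
  have hsm := fun A c => Matrix.det_smul (n := Fin d) (R := K) A c
  simp only [Fintype.card_fin] at hsm
  rw [← hsm]
  congr 1
  ext1 a b
  simp [Matrix.sum_apply, Matrix.vecMulVec_apply, Matrix.one_apply]
  have h2 : algebraMap (Polynomial ℝ) K (Polynomial.C 2) = 2 := by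
    rw [show (Polynomial.C (2 : ℝ)) = (2 : Polynomial ℝ) from rfl, map_ofNat]
  change algebraMap (Polynomial ℝ) K Polynomial.X ≠ 0 at hx
  have hmul : ∀ w : K, algebraMap (Polynomial ℝ) K Polynomial.X *
      (-2 / algebraMap (Polynomial ℝ) K Polynomial.X * w) = -(2 * w) := by
    intro w
    rw [← mul_assoc, mul_div_cancel₀ _ hx, neg_mul]
  rw [mul_add, Finset.mul_sum, sub_eq_add_neg, ← Finset.sum_neg_distrib]
  congr 1
  · split_ifs
    · simp [sq, R]
    · simp
  · refine Finset.sum_congr rfl fun i _ => ?_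
    rw [hmul, h2]
end
end
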